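/- In the one-dimensional concentration setting, fix an integer r ≥ 0 and let ψ, χ ∈ A(𝕋) be (r+1) times continuously differentiable on [−ε,ε] with (ψ−χ)^{(s)}(0) = 0 for all 0 ≤ s ≤ r; set β_{r+1}(ε) = sup_{ξ∈[−ε,ε]} |(ψ−χ)^{(r+1)}(ξ)|. If ε is small enough so that γ(ε) ≤ σ²/2 and λ ≥ 2/σ², then ‖e^{λφ}ψ − e^{λφ}χ‖_A ≤ ‖ψ−χ‖_A · (1 + C_H(√(2/(πε)) + λ‖φ′‖_∞)) · e^{−λMε²/4} + C_{r+1}·β_{r+1}(ε)·(ε^{−1} + √(5(r+1))) / (σ²λ/2)^{r/2+1/4}, where C_H = π/√3 and C_{r+1} = (1/(r+1)!)·√((2π/3)·Γ(r+3/2)). In particular, if μ and ν are signed measures on ℤ with μ̂ = e^{λφ}ψ and ν̂ = e^{λφ}χ, then d_TV(μ,ν) is bounded by this quantity. -/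

import Mathlib

open scoped Real
open MeasureTheory Filter Asymptotics Topology

noncomputable section

/-- `n`-th Fourier coefficient of a `2π`-periodic function `f : ℝ → ℂ` (function on the torus). -/
def fCoeff (f : ℝ → ℂ) (n : ℤ) : ℂ :=
  (∫ θ in (-Real.pi)..Real.pi, f θ * Complex.exp (-(Complex.I * (n : ℂ) * (θ : ℂ)))) /
    ((2 * Real.pi : ℝ) : ℂ)

/-- Norm of the Wiener algebra `A(𝕋)`. -/
def wienerNorm (f : ℝ → ℂ) : ℝ := ∑' n : ℤ, ‖fCoeff f n‖

/-- Membership in the Wiener algebra: the Fourier series of `f` converges absolutely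
and represents `f`. -/
def MemWiener (f : ℝ → ℂ) : Prop :=
  Summable (fun n : ℤ => ‖fCoeff f n‖) ∧
    ∀ ξ : ℝ, f ξ = ∑' n : ℤ, fCoeff f n * Complex.exp (Complex.I * (n : ℂ) * (ξ : ℂ))

/-- Fourier transform of a (signed) measure on `ℤ`. -/
def fhat (μ : ℤ → ℝ) (ξ : ℝ) : ℂ :=
  ∑' k : ℤ, (μ k : ℂ) * Complex.exp (Complex.I * (k : ℂ) * (ξ : ℂ))

/-- Total variation distance between two signed measures on `ℤ`. -/
def dTV (μ ν : ℤ → ℝ) : ℝ := ∑' k : ℤ, |μ k - ν k|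

/-- Local distance between two signed measures on `ℤ`. -/
def dLoc (μ ν : ℤ → ℝ) : ℝ := ⨆ k : ℤ, |μ k - ν k|

/-- Measure of the half-line `[k, +∞)`. -/
def tailMeas (μ : ℤ → ℝ) (k : ℤ) : ℝ := ∑' j : ℤ, if k ≤ j then μ j else 0

/-- Kolmogorov distance between two signed measures on `ℤ`. -/
def dKol (μ ν : ℤ → ℝ) : ℝ := ⨆ k : ℤ, |tailMeas μ k - tailMeas ν k|

/-- A signed measure on `ℤ` with finite total variation. -/
def IsFiniteSigned (μ : ℤ → ℝ) : Prop := Summable fun k => |μ k|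

/-- A probability measure on `ℤ`. -/
def IsProb (μ : ℤ → ℝ) : Prop := (∀ k, 0 ≤ μ k) ∧ Summable μ ∧ (∑' k, μ k) = 1

/-- Lévy–Khintchine exponent of an infinitely divisible law on `ℤ` with a second moment,
whose support is not contained in a proper sublattice of `ℤ`: `φ` is `2π`-periodic, twice
continuously differentiable, `e^{λφ}` is the Fourier transform of a probability measure
on `ℤ` for every `λ > 0`, and `φ(ξ) = imξ − σ²ξ²/2 + o(ξ²)` near `0` with `σ² > 0`. -/
structure LevyExponent where
  φ : ℝ → ℂ
  m : ℝ
  σ2 : ℝ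
  periodic : Function.Periodic φ (2 * Real.pi)
  smooth : ContDiff ℝ 2 φ
  σ2_pos : 0 < σ2
  taylor : (fun ξ : ℝ => φ ξ - (Complex.I * (m : ℂ) * (ξ : ℂ) - (σ2 : ℂ) * (ξ : ℂ) ^ 2 / 2))
      =o[nhds 0] fun ξ : ℝ => ξ ^ 2
  isCharFun : ∀ lam : ℝ, 0 < lam → ∃ p : ℤ → ℝ, IsProb p ∧
      ∀ ξ : ℝ, Complex.exp ((lam : ℂ) * φ ξ) = fhat p ξ

/-- `M = −sup_{ξ∈[−π,π], ξ≠0} Re(φ(ξ))/ξ²`. -/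
def Mconst (φ : ℝ → ℂ) : ℝ :=
  -sSup ((fun ξ : ℝ => (φ ξ).re / ξ ^ 2) '' (Set.Icc (-Real.pi) Real.pi \ {0}))

/-- `γ(ε) = sup_{ξ∈[−ε,ε]} |φ″(ξ) + σ²|`. -/
def gammaB (φ : ℝ → ℂ) (σ2 ε : ℝ) : ℝ :=
  sSup ((fun ξ : ℝ => ‖iteratedDeriv 2 φ ξ + (σ2 : ℂ)‖) '' Set.Icc (-ε) ε)

/-- Supremum norm of `φ′` on the torus. -/
def derivSup (φ : ℝ → ℂ) : ℝ :=
  sSup ((fun ξ : ℝ => ‖deriv φ ξ‖) '' Set.Icc (-Real.pi) Real.pi)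

/-- Supremum norm of a function on the torus. -/
def supT (f : ℝ → ℂ) : ℝ := sSup ((fun ξ : ℝ => ‖f ξ‖) '' Set.Icc (-Real.pi) Real.pi)

/-- The piecewise-linear cut function: `1` on `[−ε/2, ε/2]`, `0` outside `[−ε, ε]`,
linear interpolation in between. -/
def cut (ε ξ : ℝ) : ℝ :=
  if |ξ| ≤ ε / 2 then 1 else if ε ≤ |ξ| then 0 else 2 * (ε - |ξ|) / ε

/-- Hermite functions `G_r(x) = (d/dx)^r e^{−x²/2}`. -/
def hermiteG (r : ℕ) (x : ℝ) : ℝ := iteratedDeriv r (fun t : ℝ => Real.exp (-(t ^ 2) / 2)) x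

/-- Hypothesis (H1), uniform version: `ψ_n(ξ) − χ_n(ξ) = β_n (iξ)^{r+1}(1+o_ξ(1))`,
with `o_ξ(1)` uniform in `n`. -/
def H1unif (r : ℕ) (ψn χn : ℕ → ℝ → ℂ) (βn : ℕ → ℝ) : Prop :=
  ∀ δ : ℝ, 0 < δ → ∃ η : ℝ, 0 < η ∧ ∀ n : ℕ, ∀ ξ : ℝ, |ξ| < η →
    ‖ψn n ξ - χn n ξ - (βn n : ℂ) * (Complex.I * (ξ : ℂ)) ^ (r + 1)‖ ≤ δ * |ξ| ^ (r + 1)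

/-- Hypothesis (H1), limiting version: `ψ(ξ) − χ(ξ) = β (iξ)^{r+1}(1+o_ξ(1))` as `ξ → 0`. -/
def H1lim (r : ℕ) (ψ χ : ℝ → ℂ) (β : ℝ) : Prop :=
  (fun ξ : ℝ => ψ ξ - χ ξ - (β : ℂ) * (Complex.I * (ξ : ℂ)) ^ (r + 1))
    =o[nhds 0] fun ξ : ℝ => |ξ| ^ (r + 1)

/-- Hypothesis (H2), uniform version:
`ψ_n′(ξ) − χ_n′(ξ) = i(r+1)β_n(iξ)^r + i(r+2)γ_n(iξ)^{r+1}(1+o_ξ(1))`,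
with `o_ξ(1)` uniform in `n`. -/
def H2unif (r : ℕ) (ψn χn : ℕ → ℝ → ℂ) (βn γn : ℕ → ℝ) : Prop :=
  ∀ δ : ℝ, 0 < δ → ∃ η : ℝ, 0 < η ∧ ∀ n : ℕ, ∀ ξ : ℝ, |ξ| < η →
    ‖deriv (fun t => ψn n t - χn n t) ξ -
        (Complex.I * ((r : ℂ) + 1) * (βn n : ℂ) * (Complex.I * (ξ : ℂ)) ^ r +
          Complex.I * ((r : ℂ) + 2) * (γn n : ℂ) * (Complex.I * (ξ : ℂ)) ^ (r + 1))‖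
      ≤ δ * |ξ| ^ (r + 1)

/-- Hypothesis (H2), limiting version. -/
def H2lim (r : ℕ) (ψ χ : ℝ → ℂ) (β γ : ℝ) : Prop :=
  (fun ξ : ℝ => deriv (fun t => ψ t - χ t) ξ -
      (Complex.I * ((r : ℂ) + 1) * (β : ℂ) * (Complex.I * (ξ : ℂ)) ^ r +
        Complex.I * ((r : ℂ) + 2) * (γ : ℂ) * (Complex.I * (ξ : ℂ)) ^ (r + 1)))
    =o[nhds 0] fun ξ : ℝ => |ξ| ^ (r + 1)

/-- `C_k = (1/k!)·√((2π/3)·Γ(k+1/2))`. -/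
def Cconst (k : ℕ) : ℝ :=
  (1 / (Nat.factorial k : ℝ)) * Real.sqrt ((2 * Real.pi / 3) * Real.Gamma ((k : ℝ) + 1 / 2))

/-- `β_{r+1}(ε)`: supremum of the `(r+1)`-th derivative of `ψ−χ` on `[−ε,ε]`. -/
def betaSup (r : ℕ) (ε : ℝ) (ψ χ : ℝ → ℂ) : ℝ :=
  sSup ((fun ξ : ℝ =>
    ‖iteratedDerivWithin (r + 1) (fun t => ψ t - χ t) (Set.Icc (-ε) ε) ξ‖) '' Set.Icc (-ε) ε)

/-- Measurable and bounded on `(-π, π]`. -/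
def BM (g : ℝ → ℂ) : Prop :=
  AEStronglyMeasurable g (volume.restrict (Set.Ioc (-Real.pi) Real.pi)) ∧
    ∃ C : ℝ, ∀ x ∈ Set.Ioc (-Real.pi) Real.pi, ‖g x‖ ≤ C

lemma negpi_le_pi : -Real.pi ≤ Real.pi := by linarith [Real.pi_pos]
lemma negpi_lt_pi : -Real.pi < Real.pi := by linarith [Real.pi_pos]

lemma BM.memLp {g : ℝ → ℂ} (h : BM g) (p : ENNReal) :
    MemLp g p (volume.restrict (Set.Ioc (-Real.pi) Real.pi)) := by
  obtain ⟨hm, C, hC⟩ := h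
  refine MemLp.of_bound hm C ?_
  filter_upwards [ae_restrict_mem measurableSet_Ioc] with x hx using hC x hx

lemma BM.ii {g : ℝ → ℂ} (h : BM g) :
    IntervalIntegrable g volume (-Real.pi) Real.pi := by
  rw [intervalIntegrable_iff_integrableOn_Ioc_of_le negpi_le_pi]
  exact memLp_one_iff_integrable.1 (h.memLp 1)

lemma BM.mul {f g : ℝ → ℂ} (hf : BM f) (hg : BM g) : BM (fun x => f x * g x) := by
  obtain ⟨hm, C, hC⟩ := hf
  obtain ⟨hm', C', hC'⟩ := hg
  refine ⟨hm.mul hm', C * C', fun x hx => ?_⟩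
  rw [norm_mul]
  exact mul_le_mul (hC x hx) (hC' x hx) (norm_nonneg _) ((norm_nonneg _).trans (hC x hx))

lemma BM.add {f g : ℝ → ℂ} (hf : BM f) (hg : BM g) : BM (fun x => f x + g x) := by
  obtain ⟨hm, C, hC⟩ := hf
  obtain ⟨hm', C', hC'⟩ := hg
  refine ⟨hm.add hm', C + C', fun x hx => ?_⟩
  exact (norm_add_le _ _).trans (add_le_add (hC x hx) (hC' x hx))

lemma BM.of_cont {f : ℝ → ℂ} (hf : Continuous f) : BM f := by
  refine ⟨hf.aestronglyMeasurable, ?_⟩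
  obtain ⟨C, hC⟩ := (isCompact_Icc (a := -Real.pi) (b := Real.pi)).exists_bound_of_continuousOn
    hf.continuousOn
  exact ⟨C, fun x hx => hC x (Set.Ioc_subset_Icc_self hx)⟩

lemma BM.ii_exp {g : ℝ → ℂ} (h : BM g) (n : ℤ) :
    IntervalIntegrable (fun θ : ℝ => g θ * Complex.exp (-(Complex.I * (n : ℂ) * (θ : ℂ))))
      volume (-Real.pi) Real.pi :=
  (h.mul (BM.of_cont (by fun_prop))).ii

lemma fCoeff_add {f g : ℝ → ℂ} (hf : BM f) (hg : BM g) (n : ℤ) :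
    fCoeff (fun x => f x + g x) n = fCoeff f n + fCoeff g n := by
  unfold fCoeff
  rw [← add_div, ← intervalIntegral.integral_add (hf.ii_exp n) (hg.ii_exp n)]
  simp only [add_mul]

lemma fCoeff_const_mul {f : ℝ → ℂ} (c : ℂ) (n : ℤ) :
    fCoeff (fun x => c * f x) n = c * fCoeff f n := by
  unfold fCoeff
  simp only [mul_assoc, intervalIntegral.integral_const_mul, mul_div_assoc]

lemma fCoeff_sub {f g : ℝ → ℂ} (hf : BM f) (hg : BM g) (n : ℤ) :
    fCoeff (fun x => f x - g x) n = fCoeff f n - fCoeff g n := by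
  unfold fCoeff
  rw [← sub_div, ← intervalIntegral.integral_sub (hf.ii_exp n) (hg.ii_exp n)]
  simp only [sub_mul]

lemma fCoeff_eq_on (f : ℝ → ℂ) (n : ℤ) : fCoeff f n = fourierCoeffOn negpi_lt_pi f n := by
  rw [fourierCoeffOn_eq_integral]
  unfold fCoeff
  have h2 : Real.pi - -Real.pi = 2 * Real.pi := by ring
  rw [div_eq_inv_mul, Complex.real_smul]
  congr 1
  · rw [h2]; push_cast; simp
  · congr 1
    ext θ
    rw [smul_eq_mul, fourier_coe_apply, mul_comm]
    congr 2
    rw [h2]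
    have : (Real.pi : ℂ) ≠ 0 := by exact_mod_cast Real.pi_ne_zero
    push_cast
    field_simp

lemma parseval {g : ℝ → ℂ} (h : BM g) :
    HasSum (fun n : ℤ => ‖fCoeff g n‖ ^ 2)
      ((2 * Real.pi)⁻¹ * ∫ x in (-Real.pi)..Real.pi, ‖g x‖ ^ 2) := by
  have := hasSum_sq_fourierCoeffOn negpi_lt_pi (h.memLp 2)
  have h2 : Real.pi - -Real.pi = 2 * Real.pi := by ring
  simpa only [fCoeff_eq_on, h2, smul_eq_mul] using this

lemma norm_cexp_I (n : ℤ) (x : ℝ) : ‖Complex.exp (Complex.I * (n : ℂ) * (x : ℂ))‖ = 1 := by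
  rw [Complex.norm_exp]; simp

lemma norm_cexp_I' (n : ℤ) (x : ℝ) : ‖Complex.exp (-(Complex.I * (n : ℂ) * (x : ℂ)))‖ = 1 := by
  rw [Complex.norm_exp]; simp

lemma norm_fCoeff_le {g : ℝ → ℂ} {C : ℝ} (h : ∀ x ∈ Set.Ioc (-Real.pi) Real.pi, ‖g x‖ ≤ C)
    (n : ℤ) : ‖fCoeff g n‖ ≤ C := by
  unfold fCoeff
  rw [norm_div, Complex.norm_real, Real.norm_of_nonneg (by positivity),
    div_le_iff₀ (by positivity)]
  have := intervalIntegral.norm_integral_le_of_norm_le_const (a := -Real.pi) (b := Real.pi)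
    (f := fun θ : ℝ => g θ * Complex.exp (-(Complex.I * (n : ℂ) * (θ : ℂ)))) (C := C) (by
      intro x hx
      rw [Set.uIoc_of_le negpi_le_pi] at hx
      rw [norm_mul, norm_cexp_I', mul_one]
      exact h x hx)
  rwa [show Real.pi - -Real.pi = 2 * Real.pi by ring, abs_of_pos (by positivity)] at this

lemma cexp_pi_eq (n : ℤ) : Complex.exp (-(Complex.I * (n : ℂ) * ((Real.pi : ℝ) : ℂ))) =
    Complex.exp (-(Complex.I * (n : ℂ) * ((-Real.pi : ℝ) : ℂ))) := by
  rw [Complex.exp_eq_exp_iff_exists_int]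
  refine ⟨-n, ?_⟩
  push_cast; ring

lemma ibp {f f' : ℝ → ℂ} {s : Set ℝ} (hs : s.Countable)
    (hf : ContinuousOn f (Set.Icc (-Real.pi) Real.pi)) (hf' : BM f')
    (hd : ∀ x ∈ Set.Ioo (-Real.pi) Real.pi \ s, HasDerivAt f (f' x) x)
    (hend : f (-Real.pi) = f Real.pi) (n : ℤ) :
    fCoeff f' n = Complex.I * n * fCoeff f n := by
  have hfi : IntervalIntegrable (fun θ : ℝ => f θ * Complex.exp (-(Complex.I * (n : ℂ) * (θ : ℂ))))
      volume (-Real.pi) Real.pi := by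
    apply ContinuousOn.intervalIntegrable
    rw [Set.uIcc_of_le negpi_le_pi]
    exact hf.mul (by fun_prop)
  have key := integral_eq_of_hasDerivAt_off_countable_of_le
    (fun θ : ℝ => f θ * Complex.exp (-(Complex.I * (n : ℂ) * (θ : ℂ))))
    (fun θ : ℝ => f' θ * Complex.exp (-(Complex.I * (n : ℂ) * (θ : ℂ))) -
      (Complex.I * n) * (f θ * Complex.exp (-(Complex.I * (n : ℂ) * (θ : ℂ)))))
    negpi_le_pi hs (hf.mul (by fun_prop)) (by
      intro x hx
      have h1 := hd x hx
      have h2 : HasDerivAt (fun θ : ℝ => Complex.exp (-(Complex.I * (n : ℂ) * (θ : ℂ))))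
          (Complex.exp (-(Complex.I * (n : ℂ) * (x : ℂ))) * (-(Complex.I * n * 1))) x := by
        apply HasDerivAt.cexp
        exact ((hasDerivAt_id x).ofReal_comp.const_mul (Complex.I * (n : ℂ))).neg
      refine (h1.mul h2).congr_deriv ?_
      ring)
    ((hf'.ii_exp n).sub (hfi.const_mul _))
  rw [intervalIntegral.integral_sub (hf'.ii_exp n) (hfi.const_mul _),
    intervalIntegral.integral_const_mul, hend, cexp_pi_eq, sub_self, sub_eq_zero] at key
  unfold fCoeff
  rw [key, mul_div_assoc]

lemma series_cont {a : ℤ → ℂ} (ha : Summable (fun k => ‖a k‖)) :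
    Continuous (fun ξ : ℝ => ∑' k : ℤ, a k * Complex.exp (Complex.I * (k : ℂ) * (ξ : ℂ))) := by
  refine continuous_tsum (fun k => by fun_prop) ha (fun k x => ?_)
  rw [norm_mul, norm_cexp_I, mul_one]

lemma fCoeff_conv {a : ℤ → ℂ} (ha : Summable (fun k => ‖a k‖)) {F : ℝ → ℂ} (hF : BM F) (n : ℤ) :
    fCoeff (fun ξ : ℝ => (∑' k : ℤ, a k * Complex.exp (Complex.I * (k : ℂ) * (ξ : ℂ))) * F ξ) n =
      ∑' k : ℤ, a k * fCoeff F (n - k) := by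
  obtain ⟨hm, C, hC⟩ := id hF
  have key := intervalIntegral.hasSum_integral_of_dominated_convergence
    (μ := volume) (a := -Real.pi) (b := Real.pi)
    (F := fun (k : ℤ) (θ : ℝ) => a k * (F θ * Complex.exp (-(Complex.I * ((n - k : ℤ) : ℂ) * (θ : ℂ)))))
    (f := fun θ : ℝ => (∑' k : ℤ, a k * Complex.exp (Complex.I * (k : ℂ) * (θ : ℂ))) * F θ *
      Complex.exp (-(Complex.I * (n : ℂ) * (θ : ℂ))))
    (fun k _ => ‖a k‖ * C) (by
      intro k
      rw [Set.uIoc_of_le negpi_le_pi]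
      exact (hm.mul (by fun_prop)).const_mul _) (by
      intro k
      refine Eventually.of_forall fun x hx => ?_
      rw [Set.uIoc_of_le negpi_le_pi] at hx
      rw [norm_mul, norm_mul, norm_cexp_I', mul_one]
      exact mul_le_mul_of_nonneg_left (hC x hx) (norm_nonneg _))
      (Eventually.of_forall fun x hx => ha.mul_right C) (by simp) (by
      refine Eventually.of_forall fun x hx => ?_
      have h1 : Summable (fun k : ℤ => a k * Complex.exp (Complex.I * (k : ℂ) * (x : ℂ))) := by
        apply Summable.of_norm
        simpa only [norm_mul, norm_cexp_I, mul_one] using ha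
      have h2 := h1.hasSum.mul_right (F x * Complex.exp (-(Complex.I * (n : ℂ) * (x : ℂ))))
      have h3 : ∀ k : ℤ, a k * (F x * Complex.exp (-(Complex.I * ((n - k : ℤ) : ℂ) * (x : ℂ)))) =
          a k * Complex.exp (Complex.I * (k : ℂ) * (x : ℂ)) *
            (F x * Complex.exp (-(Complex.I * (n : ℂ) * (x : ℂ)))) := by
        intro k
        have : Complex.exp (-(Complex.I * ((n - k : ℤ) : ℂ) * (x : ℂ))) =
          Complex.exp (Complex.I * (k : ℂ) * (x : ℂ)) *
            Complex.exp (-(Complex.I * (n : ℂ) * (x : ℂ))) := by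
          rw [← Complex.exp_add]; congr 1; push_cast; ring
        rw [this]; ring
      simp only [h3]
      simpa only [mul_assoc] using h2)
  unfold fCoeff
  rw [← key.tsum_eq, ← tsum_div_const]
  congr 1
  ext k
  rw [intervalIntegral.integral_const_mul, mul_div_assoc]

lemma fCoeff_one (n : ℤ) : fCoeff (fun _ => 1) n = if n = 0 then 1 else 0 := by
  split_ifs with h
  · subst h
    unfold fCoeff
    have : (Real.pi : ℂ) ≠ 0 := by exact_mod_cast Real.pi_ne_zero
    simp
    field_simp
    norm_num
  · have := ibp (f := fun _ => 1) (f' := fun _ => 0) Set.countable_empty (by fun_prop)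
      (BM.of_cont (by fun_prop)) (fun x _ => hasDerivAt_const x 1) rfl n
    have h0 : fCoeff (fun _ => 0) n = 0 := by simp [fCoeff]
    rw [h0] at this
    have hn : Complex.I * (n : ℂ) ≠ 0 := mul_ne_zero Complex.I_ne_zero (by exact_mod_cast h)
    exact (mul_eq_zero.1 this.symm).resolve_left hn

lemma fCoeff_series {a : ℤ → ℂ} (ha : Summable (fun k => ‖a k‖)) (n : ℤ) :
    fCoeff (fun ξ : ℝ => ∑' k : ℤ, a k * Complex.exp (Complex.I * (k : ℂ) * (ξ : ℂ))) n = a n := by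
  have := fCoeff_conv ha (F := fun _ => 1) (BM.of_cont (by fun_prop)) n
  simp only [mul_one] at this
  rw [this, tsum_eq_single n]
  · simp [fCoeff_one]
  · intro k hk
    rw [fCoeff_one, if_neg (by omega), mul_zero]

lemma wiener_prod {h : ℝ → ℂ} (hh : MemWiener h) {F : ℝ → ℂ} (hF : BM F)
    (hFs : Summable (fun n => ‖fCoeff F n‖)) :
    Summable (fun n => ‖fCoeff (fun ξ => h ξ * F ξ) n‖) ∧
      ∑' n, ‖fCoeff (fun ξ => h ξ * F ξ) n‖ ≤ wienerNorm h * ∑' n, ‖fCoeff F n‖ := by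
  obtain ⟨hs, hr⟩ := hh
  have hc : ∀ n, fCoeff (fun ξ => h ξ * F ξ) n = ∑' k : ℤ, fCoeff h k * fCoeff F (n - k) := by
    intro n
    rw [← fCoeff_conv hs hF n]
    congr 1
    ext ξ
    rw [hr ξ]
  let e : ℤ × ℤ ≃ ℤ × ℤ :=
    { toFun := fun p => (p.2, p.1 - p.2)
      invFun := fun p => (p.1 + p.2, p.1)
      left_inv := fun p => by ext <;> simp
      right_inv := fun p => by ext <;> simp }
  have h1 : HasSum (fun p : ℤ × ℤ => ‖fCoeff h p.1‖ * ‖fCoeff F p.2‖)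
      (wienerNorm h * ∑' n, ‖fCoeff F n‖) :=
    hs.hasSum.mul hFs.hasSum (hs.mul_of_nonneg hFs (fun _ => norm_nonneg _) (fun _ => norm_nonneg _))
  have h2 : HasSum (fun p : ℤ × ℤ => ‖fCoeff h p.2‖ * ‖fCoeff F (p.1 - p.2)‖)
      (wienerNorm h * ∑' n, ‖fCoeff F n‖) := by
    have h := (e.hasSum_iff (f := fun p : ℤ × ℤ => ‖fCoeff h p.1‖ * ‖fCoeff F p.2‖)).2 h1
    exact h
  have h3 : HasSum (fun n : ℤ => ∑' k : ℤ, ‖fCoeff h k‖ * ‖fCoeff F (n - k)‖)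
      (wienerNorm h * ∑' n, ‖fCoeff F n‖) :=
    h2.prod_fiberwise (fun n => (h2.summable.prod_factor n).hasSum)
  have hle : ∀ n, ‖fCoeff (fun ξ => h ξ * F ξ) n‖ ≤ ∑' k : ℤ, ‖fCoeff h k‖ * ‖fCoeff F (n - k)‖ := by
    intro n
    rw [hc]
    refine (norm_tsum_le_tsum_norm ?_).trans (le_of_eq ?_)
    · simpa only [norm_mul] using h2.summable.prod_factor n
    · simp only [norm_mul]
  have hsum := Summable.of_nonneg_of_le (fun _ => norm_nonneg _) hle h3.summable
  exact ⟨hsum, (hsum.tsum_le_tsum hle h3.summable).trans h3.tsum_eq.le⟩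

lemma cs_tsum {u d : ℤ → ℝ} (hu : ∀ n, 0 ≤ u n) (hd : ∀ n, 0 ≤ d n)
    (hus : Summable (fun n => u n ^ 2)) (hds : Summable (fun n => d n ^ 2)) :
    Summable (fun n => u n * d n) ∧
      ∑' n, u n * d n ≤ Real.sqrt (∑' n, u n ^ 2) * Real.sqrt (∑' n, d n ^ 2) := by
  have hp : Real.HolderConjugate 2 2 := Real.HolderConjugate.two_two
  have hus' : Summable (fun n => u n ^ (2 : ℝ)) := by simpa using hus
  have hds' : Summable (fun n => d n ^ (2 : ℝ)) := by simpa using hds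
  refine ⟨Real.summable_mul_of_Lp_Lq_of_nonneg hp hu hd hus' hds', ?_⟩
  have := Real.inner_le_Lp_mul_Lq_tsum_of_nonneg hp hu hd hus' hds'
  simpa [Real.sqrt_eq_rpow] using this
lemma hasSum_telescope (c : ℝ) (hc : 0 < c) :
    HasSum (fun n : ℕ => 1 / ((n : ℝ) + c) - 1 / ((n : ℝ) + 1 + c)) (1 / c) := by
  have hpos : ∀ n : ℕ, 0 ≤ 1 / ((n : ℝ) + c) - 1 / ((n : ℝ) + 1 + c) := by
    intro n
    rw [sub_nonneg]
    apply one_div_le_one_div_of_le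
    · positivity
    · linarith
  rw [hasSum_iff_tendsto_nat_of_nonneg hpos]
  have h1 : ∀ n : ℕ, ∑ i ∈ Finset.range n, (1 / ((i : ℝ) + c) - 1 / ((i : ℝ) + 1 + c)) =
      1 / c - 1 / ((n : ℝ) + c) := by
    intro n
    induction n with
    | zero => simp
    | succ k ih => rw [Finset.sum_range_succ, ih]; push_cast; ring
  simp only [h1]
  have h2 : Tendsto (fun n : ℕ => 1 / ((n : ℝ) + c)) atTop (𝓝 0) := by
    simp only [one_div]
    exact tendsto_inv_atTop_zero.comp (tendsto_atTop_add_const_right _ _ tendsto_natCast_atTop_atTop)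
  simpa using h2.const_sub (1 / c)

lemma term_bound (p : ℕ) (y : ℝ) (hy : (p : ℝ) ≤ |y|) :
    1 / (16 + y ^ 2) ≤ 2 * (1 / ((p : ℝ) + 7 / 2) - 1 / ((p : ℝ) + 1 + 7 / 2)) := by
  have hp : (0 : ℝ) ≤ p := Nat.cast_nonneg p
  have hy2 : (p : ℝ) ^ 2 ≤ y ^ 2 := by
    rw [← sq_abs y]; exact pow_le_pow_left₀ hp hy 2
  have h1 : 1 / (16 + y ^ 2) ≤ 1 / (16 + (p : ℝ) ^ 2) := by
    apply one_div_le_one_div_of_le <;> nlinarith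
  refine h1.trans ?_
  rw [div_sub_div _ _ (by positivity) (by positivity), mul_div_assoc', div_le_div_iff₀ (by positivity) (by positivity)]
  nlinarith [sq_nonneg ((p : ℝ) - 4)]

lemma weight_sum (x : ℝ) : Summable (fun n : ℤ => 1 / (16 + ((n : ℝ) - x) ^ 2)) ∧
    ∑' n : ℤ, 1 / (16 + ((n : ℝ) - x) ^ 2) ≤ 8 / 7 := by
  have hT := (hasSum_telescope (7 / 2) (by norm_num)).mul_left 2
  set T : ℕ → ℝ := fun n => 2 * (1 / ((n : ℝ) + 7 / 2) - 1 / ((n : ℝ) + 1 + 7 / 2)) with hTdef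
  let f : ℤ → ℝ := fun n => 1 / (16 + ((n : ℝ) - x) ^ 2)
  let e : ℤ ≃ ℤ := Equiv.addRight (⌊x⌋ + 1)
  have hfl := Int.floor_le x
  have hfl' := Int.lt_floor_add_one x
  have hb1 : ∀ n : ℕ, (f ∘ e) (n : ℤ) ≤ T n := by
    intro n
    apply term_bound
    refine le_trans ?_ (le_abs_self _)
    simp only [e, Equiv.coe_addRight]; push_cast; linarith
  have hb2 : ∀ n : ℕ, (f ∘ e) (-((n : ℤ) + 1)) ≤ T n := by
    intro n
    apply term_bound
    refine le_trans ?_ (neg_le_abs _)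
    simp only [e, Equiv.coe_addRight]; push_cast; linarith
  have hf0 : ∀ n, 0 ≤ (f ∘ e) n := fun n => by simp only [Function.comp, f]; positivity
  have hs1 := Summable.of_nonneg_of_le (fun n : ℕ => hf0 n) hb1 hT.summable
  have hs2 := Summable.of_nonneg_of_le (fun n : ℕ => hf0 (-((n : ℤ) + 1))) hb2 hT.summable
  have hsum := HasSum.of_nat_of_neg_add_one hs1.hasSum hs2.hasSum
  have hsum' := e.hasSum_iff.1 hsum
  refine ⟨hsum'.summable, ?_⟩
  rw [hsum'.tsum_eq]
  have h1 := (hs1.tsum_le_tsum hb1 hT.summable).trans hT.tsum_eq.le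
  have h2 := (hs2.tsum_le_tsum hb2 hT.summable).trans hT.tsum_eq.le
  norm_num at h1 h2 ⊢
  linarith

lemma inv_sq_sum : HasSum (fun n : ℤ => (|(n : ℝ)|⁻¹) ^ 2) (Real.pi ^ 2 / 3) := by
  have h1 : HasSum (fun n : ℕ => (|((n : ℤ) : ℝ)|⁻¹) ^ 2) (Real.pi ^ 2 / 6) := by
    simpa using hasSum_zeta_two
  have h2 : HasSum (fun n : ℕ => (|((-((n : ℤ) + 1) : ℤ) : ℝ)|⁻¹) ^ 2) (Real.pi ^ 2 / 6) := by
    have h3 := (hasSum_nat_add_iff' (f := fun n : ℕ => 1 / (n : ℝ) ^ 2) 1).2 hasSum_zeta_two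
    have h4 : ∀ n : ℕ, (|((-((n : ℤ) + 1) : ℤ) : ℝ)|⁻¹) ^ 2 = 1 / ((n + 1 : ℕ) : ℝ) ^ 2 := by
      intro n
      rw [inv_pow, sq_abs, one_div]
      congr 1
      push_cast
      ring
    simp only [h4]
    have h5 : Real.pi ^ 2 / 6 - ∑ i ∈ Finset.range 1, 1 / (i : ℝ) ^ 2 = Real.pi ^ 2 / 6 := by
      simp
    rw [h5] at h3
    exact h3
  have := HasSum.of_nat_of_neg_add_one (f := fun n : ℤ => (|(n : ℝ)|⁻¹) ^ 2) h1 h2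
  rw [show Real.pi ^ 2 / 3 = Real.pi ^ 2 / 6 + Real.pi ^ 2 / 6 by ring]
  exact this

/-- normalised `L²` norm squared -/
def PP (g : ℝ → ℂ) : ℝ := (2 * Real.pi)⁻¹ * ∫ x in (-Real.pi)..Real.pi, ‖g x‖ ^ 2

lemma lemA {F d e : ℝ → ℂ} {E : ℝ} (hd : BM d) (he : BM e)
    (hFE : ∀ x ∈ Set.Ioc (-Real.pi) Real.pi, ‖F x‖ ≤ E)
    (hc : ∀ n : ℤ, fCoeff d n + fCoeff e n = Complex.I * n * fCoeff F n) :
    Summable (fun n => ‖fCoeff F n‖) ∧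
      ∑' n, ‖fCoeff F n‖ ≤ E + Real.pi / Real.sqrt 3 * (Real.sqrt (PP d) + Real.sqrt (PP e)) := by
  have hdS := parseval hd
  have heS := parseval he
  have hu := inv_sq_sum
  obtain ⟨s1, l1⟩ := cs_tsum (u := fun n : ℤ => |(n : ℝ)|⁻¹) (d := fun n => ‖fCoeff d n‖)
    (fun n => by positivity) (fun n => norm_nonneg _) hu.summable hdS.summable
  obtain ⟨s2, l2⟩ := cs_tsum (u := fun n : ℤ => |(n : ℝ)|⁻¹) (d := fun n => ‖fCoeff e n‖)
    (fun n => by positivity) (fun n => norm_nonneg _) hu.summable heS.summable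
  rw [hu.tsum_eq, hdS.tsum_eq] at l1
  rw [hu.tsum_eq, heS.tsum_eq] at l2
  have hsq : Real.sqrt (Real.pi ^ 2 / 3) = Real.pi / Real.sqrt 3 := by
    rw [Real.sqrt_div (by positivity), Real.sqrt_sq Real.pi_pos.le]
  rw [hsq] at l1 l2
  have s0 : HasSum (fun n : ℤ => if n = 0 then E else 0) E := hasSum_ite_eq 0 E
  have hsum := s0.add (s1.hasSum.add s2.hasSum)
  have hle : ∀ n : ℤ, ‖fCoeff F n‖ ≤ (if n = 0 then E else 0) +
      (|(n : ℝ)|⁻¹ * ‖fCoeff d n‖ + |(n : ℝ)|⁻¹ * ‖fCoeff e n‖) := by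
    intro n
    by_cases hn : n = 0
    · subst hn
      simpa using norm_fCoeff_le hFE 0
    · rw [if_neg hn, zero_add]
      have hn' : (0 : ℝ) < |(n : ℝ)| := abs_pos.2 (by exact_mod_cast hn)
      have h1 : |(n : ℝ)| * ‖fCoeff F n‖ ≤ ‖fCoeff d n‖ + ‖fCoeff e n‖ := by
        have h2 := congrArg norm (hc n)
        rw [norm_mul, norm_mul, Complex.norm_I, one_mul, Complex.norm_intCast] at h2
        rw [← h2]
        exact norm_add_le _ _
      rw [← mul_add, le_inv_mul_iff₀ hn']
      exact h1
  have hS := Summable.of_nonneg_of_le (fun n => norm_nonneg _) hle hsum.summable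
  refine ⟨hS, (hS.tsum_le_tsum hle hsum.summable).trans ?_⟩
  rw [hsum.tsum_eq]
  unfold PP
  linarith

lemma lemB {f d e : ℝ → ℂ} {x : ℝ} (hf : BM f) (hd : BM d) (he : BM e)
    (hc : ∀ n : ℤ, fCoeff d n + fCoeff e n = Complex.I * ((n : ℝ) - x : ℝ) * fCoeff f n) :
    Summable (fun n => ‖fCoeff f n‖) ∧
      ∑' n, ‖fCoeff f n‖ ≤
        Real.sqrt (8 / 7) * (Real.sqrt (PP d) + Real.sqrt (16 * PP f + PP e)) := by
  have hfS := parseval hf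
  have hdS := parseval hd
  have heS := parseval he
  obtain ⟨hu, hu'⟩ := weight_sum x
  set u : ℤ → ℝ := fun n => (Real.sqrt (16 + ((n : ℝ) - x) ^ 2))⁻¹ with hudef
  have hu2 : ∀ n : ℤ, u n ^ 2 = 1 / (16 + ((n : ℝ) - x) ^ 2) := by
    intro n
    rw [hudef]; simp only
    rw [inv_pow, Real.sq_sqrt (by positivity), one_div]
  set s : ℤ → ℝ := fun n => Real.sqrt (16 * ‖fCoeff f n‖ ^ 2 + ‖fCoeff e n‖ ^ 2) with hsdef
  have hs2 : ∀ n : ℤ, s n ^ 2 = 16 * ‖fCoeff f n‖ ^ 2 + ‖fCoeff e n‖ ^ 2 := by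
    intro n
    rw [hsdef]; simp only
    rw [Real.sq_sqrt (by positivity)]
  have hsS : HasSum (fun n => s n ^ 2) (16 * PP f + PP e) := by
    simp only [hs2]
    exact (hfS.mul_left 16).add heS
  simp only [← hu2] at hu hu'
  obtain ⟨s1, l1⟩ := cs_tsum (u := u) (d := fun n => ‖fCoeff d n‖)
    (fun n => by positivity) (fun n => norm_nonneg _) hu hdS.summable
  obtain ⟨s2, l2⟩ := cs_tsum (u := u) (d := s)
    (fun n => by positivity) (fun n => Real.sqrt_nonneg _) hu hsS.summable
  rw [hdS.tsum_eq] at l1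
  rw [hsS.tsum_eq] at l2
  have hsq := Real.sqrt_le_sqrt hu'
  have hsum := s1.hasSum.add s2.hasSum
  have hle : ∀ n : ℤ, ‖fCoeff f n‖ ≤ u n * ‖fCoeff d n‖ + u n * s n := by
    intro n
    have hw : 0 < Real.sqrt (16 + ((n : ℝ) - x) ^ 2) := Real.sqrt_pos.2 (by positivity)
    rw [← mul_add, le_inv_mul_iff₀ hw]
    have hs0 : 0 ≤ s n := Real.sqrt_nonneg _
    have hes : ‖fCoeff e n‖ ≤ s n := by
      apply Real.le_sqrt_of_sq_le
      nlinarith [sq_nonneg ‖fCoeff f n‖]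
    have h2 := congrArg norm (hc n)
    rw [norm_mul, norm_mul, Complex.norm_I, one_mul, Complex.norm_real, Real.norm_eq_abs] at h2
    have h3 : |(n : ℝ) - x| * ‖fCoeff f n‖ ≤ ‖fCoeff d n‖ + ‖fCoeff e n‖ := by
      rw [← h2]; exact norm_add_le _ _
    have h4 := pow_le_pow_left₀ (by positivity) h3 2
    rw [mul_pow, sq_abs] at h4
    refine (pow_le_pow_iff_left₀ (by positivity) (by positivity) two_ne_zero).1 ?_
    rw [mul_pow, Real.sq_sqrt (by positivity)]
    nlinarith [hs2 n, mul_le_mul_of_nonneg_left hes (norm_nonneg (fCoeff d n))]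
  have hS := Summable.of_nonneg_of_le (fun n => norm_nonneg _) hle hsum.summable
  refine ⟨hS, (hS.tsum_le_tsum hle hsum.summable).trans ?_⟩
  rw [hsum.tsum_eq, mul_add]
  exact add_le_add (l1.trans (mul_le_mul_of_nonneg_right hsq (Real.sqrt_nonneg _)))
    (l2.trans (mul_le_mul_of_nonneg_right hsq (Real.sqrt_nonneg _)))

lemma one_step_pos {f f' : ℝ → ℂ} {b C : ℝ} {n : ℕ}
    (hf : ∀ y ∈ Set.Icc 0 b, HasDerivWithinAt f (f' y) (Set.Icc 0 b) y) (h0 : f 0 = 0)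
    (hb : ∀ y ∈ Set.Icc 0 b, ‖f' y‖ ≤ C * y ^ n / (n.factorial : ℝ)) {x : ℝ}
    (hx : x ∈ Set.Icc 0 b) : ‖f x‖ ≤ C * x ^ (n + 1) / ((n + 1).factorial : ℝ) := by
  refine image_norm_le_of_norm_deriv_right_le_deriv_boundary (a := 0) (b := b) (f := f) (f' := f')
    (B := fun x => C * x ^ (n + 1) / ((n + 1).factorial : ℝ))
    (B' := fun x => C * x ^ n / (n.factorial : ℝ))
    (fun y hy => (hf y hy).continuousWithinAt) ?_ (by simp [h0]) ?_
    (fun y hy => hb y (Set.Ico_subset_Icc_self hy)) hx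
  · intro y hy
    have h1 := hf y (Set.Ico_subset_Icc_self hy)
    have h2 : Set.Icc 0 b ∈ 𝓝[Set.Ici y] y :=
      mem_of_superset (Icc_mem_nhdsGE hy.2) (Set.Icc_subset_Icc_left hy.1)
    exact h1.mono_of_mem_nhdsWithin h2
  · intro y
    have h1 := ((hasDerivAt_pow (n + 1) y).const_mul C).div_const ((n + 1).factorial : ℝ)
    refine h1.congr_deriv ?_
    have hn : ((n + 1 : ℕ) : ℝ) ≠ 0 := by positivity
    rw [Nat.factorial_succ]
    push_cast at hn ⊢
    field_simp

lemma one_step {f f' : ℝ → ℂ} {b C : ℝ} {n : ℕ}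
    (hf : ∀ y ∈ Set.Icc (-b) b, HasDerivWithinAt f (f' y) (Set.Icc (-b) b) y) (h0 : f 0 = 0)
    (hb : ∀ y ∈ Set.Icc (-b) b, ‖f' y‖ ≤ C * |y| ^ n / (n.factorial : ℝ)) {x : ℝ}
    (hx : x ∈ Set.Icc (-b) b) : ‖f x‖ ≤ C * |x| ^ (n + 1) / ((n + 1).factorial : ℝ) := by
  rcases le_total 0 x with h | h
  · have hsub : Set.Icc 0 b ⊆ Set.Icc (-b) b := by
      intro y hy; exact ⟨by linarith [hy.1, hy.2], hy.2⟩
    rw [abs_of_nonneg h]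
    refine one_step_pos (f := f) (f' := f') (fun y hy => (hf y (hsub hy)).mono hsub) h0
      (fun y hy => ?_) ⟨h, hx.2⟩
    have := hb y (hsub hy)
    rwa [abs_of_nonneg hy.1] at this
  · have hsub : ∀ y ∈ Set.Icc 0 b, -y ∈ Set.Icc (-b) b := by
      intro y hy; exact ⟨by linarith [hy.1, hy.2], by linarith [hy.1, hy.2]⟩
    rw [abs_of_nonpos h]
    have := one_step_pos (f := fun y => f (-y)) (f' := fun y => -f' (-y)) (b := b) (C := C) (n := n)
      (x := -x) (fun y hy => ?_) (by simpa using h0) (fun y hy => ?_)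
      ⟨by linarith, by linarith [hx.1]⟩
    · simpa using this
    · have h1 := hf (-y) (hsub y hy)
      have h2 := h1.scomp y ((hasDerivAt_neg y).hasDerivWithinAt (s := Set.Icc 0 b)) hsub
      simpa [Function.comp_def] using h2
    · have := hb (-y) (hsub y hy)
      rw [norm_neg]
      rwa [abs_neg, abs_of_nonneg hy.1] at this

lemma taylor_bound (n : ℕ) : ∀ {f : ℝ → ℂ} {b C : ℝ}, 0 < b →
    ContDiffOn ℝ n f (Set.Icc (-b) b) →
    (∀ s < n, iteratedDerivWithin s f (Set.Icc (-b) b) 0 = 0) →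
    (∀ y ∈ Set.Icc (-b) b, ‖iteratedDerivWithin n f (Set.Icc (-b) b) y‖ ≤ C) →
    ∀ x ∈ Set.Icc (-b) b, ‖f x‖ ≤ C * |x| ^ n / (n.factorial : ℝ) := by
  induction n with
  | zero =>
    intro f b C hb hf h0 hC x hx
    simpa using hC x hx
  | succ k ih =>
    intro f b C hb hf h0 hC x hx
    have hU : UniqueDiffOn ℝ (Set.Icc (-b) b) := uniqueDiffOn_Icc (by linarith)
    have hdiff : DifferentiableOn ℝ f (Set.Icc (-b) b) :=
      hf.differentiableOn (by norm_cast)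
    refine one_step (f' := derivWithin f (Set.Icc (-b) b))
      (fun y hy => (hdiff y hy).hasDerivWithinAt) ?_ ?_ hx
    · simpa using h0 0 (by omega)
    · refine ih hb (hf.derivWithin hU (by norm_cast)) ?_ ?_
      · intro s hs
        have := h0 (s + 1) (by omega)
        rwa [iteratedDerivWithin_succ'] at this
      · intro y hy
        have := hC y hy
        rwa [iteratedDerivWithin_succ'] at this

lemma gauss_moment (a : ℝ) (ha : 0 < a) (k : ℕ) :
    ∫ x in (-Real.pi)..Real.pi, x ^ (2 * k) * Real.exp (-a * x ^ 2) ≤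
      Real.Gamma ((k : ℝ) + 1 / 2) * a ^ (-((k : ℝ) + 1 / 2)) := by
  have hint : Integrable (fun x : ℝ => x ^ (2 * k) * Real.exp (-a * x ^ 2)) := by
    have := integrable_rpow_mul_exp_neg_mul_sq ha (s := ((2 * k : ℕ) : ℝ))
      (by have : (0 : ℝ) ≤ ((2 * k : ℕ) : ℝ) := Nat.cast_nonneg _
          linarith)
    simpa only [Real.rpow_natCast] using this
  have h1 : ∫ x in (-Real.pi)..Real.pi, x ^ (2 * k) * Real.exp (-a * x ^ 2) ≤
      ∫ x : ℝ, x ^ (2 * k) * Real.exp (-a * x ^ 2) := by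
    rw [intervalIntegral.integral_of_le negpi_le_pi]
    refine setIntegral_le_integral hint (Eventually.of_forall fun x => ?_)
    have : 0 ≤ x ^ (2 * k) := by rw [pow_mul]; positivity
    simp only [Pi.zero_apply]
    positivity
  refine h1.trans (le_of_eq ?_)
  have h2 := integral_comp_abs (f := fun x : ℝ => x ^ (2 * k) * Real.exp (-a * x ^ 2))
  have h3 : ∀ x : ℝ, |x| ^ (2 * k) * Real.exp (-a * |x| ^ 2) =
      x ^ (2 * k) * Real.exp (-a * x ^ 2) := by
    intro x; rw [pow_mul, sq_abs, ← pow_mul]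
  simp only [h3] at h2
  rw [h2]
  have h4 := integral_rpow_mul_exp_neg_mul_rpow (p := 2) (q := ((2 * k : ℕ) : ℝ)) (b := a)
    (by norm_num) (by have : (0 : ℝ) ≤ ((2 * k : ℕ) : ℝ) := Nat.cast_nonneg _
                      linarith) ha
  simp only [Real.rpow_natCast, Real.rpow_ofNat] at h4
  rw [h4]
  have h5 : (((2 * k : ℕ) : ℝ) + 1) / 2 = (k : ℝ) + 1 / 2 := by push_cast; ring
  rw [neg_div, h5]
  ring
lemma levy_norm_exp_le (L : LevyExponent) {lam : ℝ} (hl : 0 < lam) (ξ : ℝ) :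
    ‖Complex.exp ((lam : ℂ) * L.φ ξ)‖ ≤ 1 := by
  obtain ⟨p, ⟨hp0, hps, hp1⟩, hp⟩ := L.isCharFun lam hl
  rw [hp ξ, fhat]
  have hn : ∀ k : ℤ, ‖(p k : ℂ) * Complex.exp (Complex.I * (k : ℂ) * (ξ : ℂ))‖ = p k := by
    intro k
    rw [norm_mul, norm_cexp_I, mul_one, Complex.norm_real, Real.norm_of_nonneg (hp0 k)]
  refine (norm_tsum_le_tsum_norm ?_).trans (le_of_eq ?_)
  · simpa only [hn] using hps
  · simpa only [hn] using hp1

lemma norm_exp_lam (φ : ℝ → ℂ) (lam ξ : ℝ) :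
    ‖Complex.exp ((lam : ℂ) * φ ξ)‖ = Real.exp (lam * (φ ξ).re) := by
  rw [Complex.norm_exp]; simp

lemma levy_re_le (L : LevyExponent) (ξ : ℝ) : (L.φ ξ).re ≤ 0 := by
  have := levy_norm_exp_le L one_pos ξ
  rw [norm_exp_lam, one_mul] at this
  exact Real.exp_le_one_iff.1 this

lemma levy_zero (L : LevyExponent) : L.φ 0 = 0 := by
  have := L.taylor.def (c := 1) one_pos
  have := this.self_of_nhds
  simpa using this

lemma levy_M (L : LevyExponent) : 0 ≤ Mconst L.φ ∧
    ∀ ξ ∈ Set.Icc (-Real.pi) Real.pi, (L.φ ξ).re ≤ -(Mconst L.φ * ξ ^ 2) := by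
  set S := ((fun ξ : ℝ => (L.φ ξ).re / ξ ^ 2) '' (Set.Icc (-Real.pi) Real.pi \ {0})) with hS
  have hup : ∀ y ∈ S, y ≤ 0 := by
    rintro y ⟨ξ, -, rfl⟩
    exact div_nonpos_of_nonpos_of_nonneg (levy_re_le L ξ) (sq_nonneg ξ)
  have hM : Mconst L.φ = -sSup S := rfl
  refine ⟨?_, fun ξ hξ => ?_⟩
  · rw [hM, neg_nonneg]
    exact Real.sSup_nonpos hup
  · by_cases h0 : ξ = 0
    · subst h0; simp [levy_zero]
    · have h1 : (L.φ ξ).re / ξ ^ 2 ≤ sSup S := le_csSup ⟨0, hup⟩ ⟨ξ, ⟨hξ, h0⟩, rfl⟩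
      rw [div_le_iff₀ (by positivity)] at h1
      rw [hM]; linarith

lemma levy_diff (L : LevyExponent) (ξ : ℝ) : HasDerivAt L.φ (deriv L.φ ξ) ξ :=
  (L.smooth.differentiable (by norm_num) ξ).hasDerivAt

lemma levy_deriv_cont (L : LevyExponent) : Continuous (deriv L.φ) :=
  L.smooth.continuous_deriv (by norm_num)

lemma levy_diff2 (L : LevyExponent) (ξ : ℝ) :
    HasDerivAt (deriv L.φ) (iteratedDeriv 2 L.φ ξ) ξ := by
  have h1 : ContDiff ℝ 1 (deriv L.φ) := by
    have := L.smooth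
    rw [show (2 : WithTop ℕ∞) = 1 + 1 by norm_num, contDiff_succ_iff_deriv] at this
    exact this.2.2
  rw [iteratedDeriv_succ, iteratedDeriv_one]
  exact (h1.differentiable (by norm_num) ξ).hasDerivAt

lemma levy_g_deriv (L : LevyExponent) (ξ : ℝ) :
    HasDerivAt (fun ξ : ℝ => L.φ ξ - (Complex.I * (L.m : ℂ) * (ξ : ℂ) - (L.σ2 : ℂ) * (ξ : ℂ) ^ 2 / 2))
      (deriv L.φ ξ - (Complex.I * (L.m : ℂ) - (L.σ2 : ℂ) * (ξ : ℂ))) ξ := by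
  have h1 := (hasDerivAt_id ξ).ofReal_comp
  have h2 := (((h1.pow 2).const_mul (L.σ2 : ℂ)).div_const 2)
  have h3 := (levy_diff L ξ).sub ((h1.const_mul (Complex.I * (L.m : ℂ))).sub h2)
  refine h3.congr_deriv ?_
  simp
  ring

lemma levy_g'_deriv (L : LevyExponent) (ξ : ℝ) :
    HasDerivAt (fun ξ : ℝ => deriv L.φ ξ - (Complex.I * (L.m : ℂ) - (L.σ2 : ℂ) * (ξ : ℂ)))
      (iteratedDeriv 2 L.φ ξ + (L.σ2 : ℂ)) ξ := by
  have h1 := (hasDerivAt_id ξ).ofReal_comp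
  have h3 := (levy_diff2 L ξ).sub ((hasDerivAt_const ξ (Complex.I * (L.m : ℂ))).sub
    (h1.const_mul (L.σ2 : ℂ)))
  refine h3.congr_deriv ?_
  simp

lemma levy_deriv_zero (L : LevyExponent) : deriv L.φ 0 = Complex.I * (L.m : ℂ) := by
  have h1 := levy_g_deriv L 0
  have h2 : HasDerivAt (fun ξ : ℝ => L.φ ξ - (Complex.I * (L.m : ℂ) * (ξ : ℂ) -
      (L.σ2 : ℂ) * (ξ : ℂ) ^ 2 / 2)) 0 0 := by
    rw [hasDerivAt_iff_isLittleO]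
    have h3 : (fun ξ : ℝ => ξ ^ 2) =O[𝓝 0] (fun ξ : ℝ => ξ) := by
      have := (isLittleO_pow_id (𝕜 := ℝ) (n := 2) (by norm_num)).isBigO
      exact this
    have h4 := L.taylor.trans_isBigO h3
    simpa [levy_zero] using h4
  have := h1.unique h2
  simp at this
  exact sub_eq_zero.1 this

lemma levy_local (L : LevyExponent) {ε : ℝ}
    (hγ : gammaB L.φ L.σ2 ε ≤ L.σ2 / 2) : ∀ ξ ∈ Set.Icc (-ε) ε,
      ‖deriv L.φ ξ - Complex.I * (L.m : ℂ)‖ ≤ 3 / 2 * L.σ2 * |ξ| ∧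
        (L.φ ξ).re ≤ -(L.σ2 * ξ ^ 2 / 4) := by
  have hσ := L.σ2_pos
  have hcont : Continuous (fun ξ : ℝ => ‖iteratedDeriv 2 L.φ ξ + (L.σ2 : ℂ)‖) := by
    have := L.smooth.continuous_iteratedDeriv 2 (by norm_num)
    fun_prop
  have hb : ∀ y ∈ Set.Icc (-ε) ε, ‖iteratedDeriv 2 L.φ y + (L.σ2 : ℂ)‖ ≤ L.σ2 / 2 := by
    intro y hy
    refine le_trans ?_ hγ
    exact le_csSup (isCompact_Icc.bddAbove_image hcont.continuousOn) ⟨y, hy, rfl⟩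
  have h1 : ∀ y ∈ Set.Icc (-ε) ε,
      ‖deriv L.φ y - (Complex.I * (L.m : ℂ) - (L.σ2 : ℂ) * (y : ℂ))‖ ≤
        L.σ2 / 2 * |y| ^ (0 + 1) / ((0 + 1).factorial : ℝ) := by
    intro y hy
    refine one_step (f := fun ξ : ℝ => deriv L.φ ξ - (Complex.I * (L.m : ℂ) - (L.σ2 : ℂ) * (ξ : ℂ)))
      (fun z _ => (levy_g'_deriv L z).hasDerivWithinAt) ?_ ?_ hy
    · simp [levy_deriv_zero]
    · intro z hz; simpa using hb z hz
  have h2 : ∀ y ∈ Set.Icc (-ε) ε,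
      ‖L.φ y - (Complex.I * (L.m : ℂ) * (y : ℂ) - (L.σ2 : ℂ) * (y : ℂ) ^ 2 / 2)‖ ≤
        L.σ2 / 2 * |y| ^ (1 + 1) / ((1 + 1).factorial : ℝ) := by
    intro y hy
    refine one_step (f := fun ξ : ℝ => L.φ ξ - (Complex.I * (L.m : ℂ) * (ξ : ℂ) -
      (L.σ2 : ℂ) * (ξ : ℂ) ^ 2 / 2))
      (fun z _ => (levy_g_deriv L z).hasDerivWithinAt) ?_ ?_ hy
    · simp [levy_zero]
    · intro z hz; simpa using h1 z hz
  intro ξ hξ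
  constructor
  · have h3 := h1 ξ hξ
    simp only [zero_add, pow_one, Nat.factorial_one, Nat.cast_one, div_one] at h3
    have h4 : deriv L.φ ξ - Complex.I * (L.m : ℂ) =
        (deriv L.φ ξ - (Complex.I * (L.m : ℂ) - (L.σ2 : ℂ) * (ξ : ℂ))) - (L.σ2 : ℂ) * (ξ : ℂ) := by
      ring
    rw [h4]
    refine (norm_sub_le _ _).trans ?_
    rw [norm_mul, Complex.norm_real, Complex.norm_real, Real.norm_of_nonneg hσ.le, Real.norm_eq_abs]
    linarith
  · have h3 := h2 ξ hξ
    have h4 := (Complex.re_le_norm _).trans h3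
    have h5 : (L.φ ξ - (Complex.I * (L.m : ℂ) * (ξ : ℂ) - (L.σ2 : ℂ) * (ξ : ℂ) ^ 2 / 2)).re =
        (L.φ ξ).re + L.σ2 * ξ ^ 2 / 2 := by
      have : (L.σ2 : ℂ) * (ξ : ℂ) ^ 2 / 2 = ((L.σ2 * ξ ^ 2 / 2 : ℝ) : ℂ) := by push_cast; ring
      rw [this, Complex.sub_re, Complex.sub_re, Complex.ofReal_re]
      simp
    rw [h5] at h4
    norm_num at h4
    linarith

lemma cut_eq (ε ξ : ℝ) (hε : 0 < ε) : cut ε ξ = max 0 (min 1 (2 * (ε - |ξ|) / ε)) := by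
  unfold cut
  split_ifs with h1 h2
  · rw [min_eq_left, max_eq_right zero_le_one]
    rw [le_div_iff₀ hε]; linarith
  · rw [max_eq_left]
    refine (min_le_right _ _).trans ?_
    exact div_nonpos_of_nonpos_of_nonneg (by linarith) hε.le
  · rw [min_eq_right, max_eq_right]
    · exact div_nonneg (by linarith) hε.le
    · rw [div_le_iff₀ hε]; linarith

lemma cut_cont (ε : ℝ) (hε : 0 < ε) : Continuous (cut ε) := by
  have : cut ε = fun ξ => max 0 (min 1 (2 * (ε - |ξ|) / ε)) := funext fun ξ => cut_eq ε ξ hε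
  rw [this]
  fun_prop

lemma cut_nonneg (ε ξ : ℝ) (hε : 0 < ε) : 0 ≤ cut ε ξ := by
  rw [cut_eq ε ξ hε]; exact le_max_left _ _

lemma cut_le_one (ε ξ : ℝ) (hε : 0 < ε) : cut ε ξ ≤ 1 := by
  rw [cut_eq ε ξ hε]; exact max_le zero_le_one (min_le_left _ _)

lemma cut_zero (ε ξ : ℝ) (hε : 0 < ε) (h : ε ≤ |ξ|) : cut ε ξ = 0 := by
  unfold cut
  rw [if_neg (by linarith), if_pos h]

/-- a.e. derivative of `cut`. -/
def cutD (ε ξ : ℝ) : ℝ :=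
  if ε / 2 < ξ ∧ ξ < ε then -(2 / ε) else if -ε < ξ ∧ ξ < -(ε / 2) then 2 / ε else 0

lemma cutD_meas (ε : ℝ) : Measurable (cutD ε) := by
  unfold cutD
  refine Measurable.ite measurableSet_Ioo measurable_const
    (Measurable.ite measurableSet_Ioo measurable_const measurable_const)

lemma cutD_zero (ε ξ : ℝ) (hε : 0 < ε) (h : |ξ| ≤ ε / 2 ∨ ε ≤ |ξ|) : cutD ε ξ = 0 := by
  unfold cutD
  rw [if_neg, if_neg]
  · rintro ⟨h1, h2⟩
    rw [abs_of_neg (by linarith)] at h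
    rcases h with h | h <;> linarith
  · rintro ⟨h1, h2⟩
    rw [abs_of_pos (by linarith)] at h
    rcases h with h | h <;> linarith

lemma cutD_abs_le (ε ξ : ℝ) (hε : 0 < ε) : |cutD ε ξ| ≤ 2 / ε := by
  unfold cutD
  have : 0 < 2 / ε := by positivity
  split_ifs
  · rw [abs_neg, abs_of_pos this]
  · rw [abs_of_pos this]
  · simpa using this.le

lemma cut_deriv (ε ξ : ℝ) (hε : 0 < ε) (h1 : ξ ≠ ε) (h2 : ξ ≠ -ε) (h3 : ξ ≠ ε / 2)
    (h4 : ξ ≠ -(ε / 2)) : HasDerivAt (cut ε) (cutD ε ξ) ξ := by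
  rcases lt_trichotomy |ξ| (ε / 2) with h | h | h
  · rw [cutD_zero ε ξ hε (Or.inl h.le)]
    refine (hasDerivAt_const ξ (1 : ℝ)).congr_of_eventuallyEq ?_
    filter_upwards [continuous_abs.continuousAt.eventually (gt_mem_nhds h)] with y hy
    unfold cut
    rw [if_pos hy.le]
  · rcases abs_choice ξ with h' | h' <;> rw [h'] at h
    · exact absurd h h3
    · exact absurd (by linarith) h4
  rcases lt_trichotomy |ξ| ε with h' | h' | h'
  · rcases le_total 0 ξ with h0 | h0
    · rw [abs_of_nonneg h0] at h h'
      have hD : cutD ε ξ = -(2 / ε) := by unfold cutD; rw [if_pos ⟨h, h'⟩]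
      rw [hD]
      have hd : HasDerivAt (fun y : ℝ => 2 * (ε - y) / ε) (-(2 / ε)) ξ := by
        refine ((((hasDerivAt_id ξ).const_sub ε).const_mul 2).div_const ε).congr_deriv ?_
        ring
      refine hd.congr_of_eventuallyEq ?_
      filter_upwards [Ioo_mem_nhds h h'] with y hy
      have hy0 : |y| = y := abs_of_pos (by linarith [hy.1])
      unfold cut
      rw [hy0, if_neg (by linarith [hy.1]), if_neg (by linarith [hy.2])]
    · rw [abs_of_nonpos h0] at h h'
      have hD : cutD ε ξ = 2 / ε := by
        unfold cutD
        rw [if_neg (by rintro ⟨ha, -⟩; linarith), if_pos ⟨by linarith, by linarith⟩]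
      rw [hD]
      have hd : HasDerivAt (fun y : ℝ => 2 * (ε - -y) / ε) (2 / ε) ξ := by
        refine (((((hasDerivAt_id ξ).neg).const_sub ε).const_mul 2).div_const ε).congr_deriv ?_
        ring
      refine hd.congr_of_eventuallyEq ?_
      filter_upwards [Ioo_mem_nhds (show -ε < ξ by linarith) (show ξ < -(ε / 2) by linarith)]
        with y hy
      have hy0 : |y| = -y := abs_of_neg (by linarith [hy.2])
      unfold cut
      rw [hy0, if_neg (by linarith [hy.2]), if_neg (by linarith [hy.1])]
  · rcases abs_choice ξ with h'' | h'' <;> rw [h''] at h'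
    · exact absurd h' h1
    · exact absurd (by linarith) h2
  · rw [cutD_zero ε ξ hε (Or.inr h'.le)]
    refine (hasDerivAt_const ξ (0 : ℝ)).congr_of_eventuallyEq ?_
    filter_upwards [continuous_abs.continuousAt.eventually (lt_mem_nhds h')] with y hy
    exact cut_zero ε y hε hy.le

lemma PP_le {g : ℝ → ℂ} (hg : BM g) {G : ℝ → ℝ}
    (hG : IntervalIntegrable G volume (-Real.pi) Real.pi)
    (h : ∀ x ∈ Set.Icc (-Real.pi) Real.pi, ‖g x‖ ^ 2 ≤ G x) :
    PP g ≤ (2 * Real.pi)⁻¹ * ∫ x in (-Real.pi)..Real.pi, G x := by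
  unfold PP
  refine mul_le_mul_of_nonneg_left ?_ (by positivity)
  refine intervalIntegral.integral_mono_on negpi_le_pi ?_ hG h
  rw [intervalIntegrable_iff_integrableOn_Ioc_of_le negpi_le_pi]
  exact (hg.memLp 2).integrable_norm_pow (by norm_num)

lemma PP_le_const {g : ℝ → ℂ} (hg : BM g) {C : ℝ}
    (h : ∀ x ∈ Set.Icc (-Real.pi) Real.pi, ‖g x‖ ^ 2 ≤ C) : PP g ≤ C := by
  have := PP_le hg (G := fun _ => C) (by simp) h
  refine this.trans (le_of_eq ?_)
  rw [intervalIntegral.integral_const, smul_eq_mul]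
  have := Real.pi_pos
  field_simp
  ring
lemma partF (L : LevyExponent) {ε lam : ℝ} (hε0 : 0 < ε) (hεπ : ε ≤ Real.pi) (hl : 0 < lam) :
    BM (fun ξ : ℝ => ((1 - cut ε ξ : ℝ) : ℂ) * Complex.exp ((lam : ℂ) * L.φ ξ)) ∧
    Summable (fun n => ‖fCoeff
      (fun ξ : ℝ => ((1 - cut ε ξ : ℝ) : ℂ) * Complex.exp ((lam : ℂ) * L.φ ξ)) n‖) ∧
    ∑' n, ‖fCoeff (fun ξ : ℝ => ((1 - cut ε ξ : ℝ) : ℂ) * Complex.exp ((lam : ℂ) * L.φ ξ)) n‖ ≤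
      (1 + (Real.pi / Real.sqrt 3) *
              (Real.sqrt (2 / (Real.pi * ε)) + lam * derivSup L.φ)) *
            Real.exp (-(lam * Mconst L.φ * ε ^ 2) / 4) := by
  have hpi := Real.pi_pos
  obtain ⟨hM0, hM⟩ := levy_M L
  set K := Real.exp (-(lam * Mconst L.φ * ε ^ 2) / 4) with hK
  have hK0 : 0 < K := Real.exp_pos _
  have hcut := cut_cont ε hε0
  have hφ : Continuous L.φ := L.smooth.continuous
  have hφ' := levy_deriv_cont L
  have hEc : Continuous (fun ξ : ℝ => Complex.exp ((lam : ℂ) * L.φ ξ)) := by fun_prop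
  have hFc : Continuous (fun ξ : ℝ => ((1 - cut ε ξ : ℝ) : ℂ) * Complex.exp ((lam : ℂ) * L.φ ξ)) := by
    fun_prop
  -- bound on the exponential away from zero
  have hE : ∀ ξ ∈ Set.Icc (-Real.pi) Real.pi, ε / 2 ≤ |ξ| →
      ‖Complex.exp ((lam : ℂ) * L.φ ξ)‖ ≤ K := by
    intro ξ hξ h
    rw [norm_exp_lam, hK]
    apply Real.exp_le_exp.2
    have h1 := hM ξ hξ
    have h2 : (ε / 2) ^ 2 ≤ ξ ^ 2 := by
      rw [← sq_abs ξ]; exact pow_le_pow_left₀ (by positivity) h 2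
    have h3 := mul_le_mul_of_nonneg_left h2 hM0
    have h4 : (L.φ ξ).re ≤ -(Mconst L.φ * (ε / 2) ^ 2) := by linarith
    have h5 := mul_le_mul_of_nonneg_left h4 hl.le
    calc lam * (L.φ ξ).re ≤ lam * -(Mconst L.φ * (ε / 2) ^ 2) := h5
      _ = _ := by ring
  have hcE : ∀ ξ ∈ Set.Icc (-Real.pi) Real.pi,
      (1 - cut ε ξ) * ‖Complex.exp ((lam : ℂ) * L.φ ξ)‖ ≤ K := by
    intro ξ hξ
    rcases le_total (|ξ|) (ε / 2) with h | h
    · have : cut ε ξ = 1 := by unfold cut; rw [if_pos h]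
      rw [this]; simpa using hK0.le
    · have h1 := hE ξ hξ h
      have h2 := cut_nonneg ε ξ hε0
      have h3 := cut_le_one ε ξ hε0
      nlinarith [norm_nonneg (Complex.exp ((lam : ℂ) * L.φ ξ))]
  have hn1 : ∀ ξ, ‖((1 - cut ε ξ : ℝ) : ℂ)‖ = 1 - cut ε ξ := fun ξ => by
    rw [Complex.norm_real, Real.norm_of_nonneg (by linarith [cut_le_one ε ξ hε0])]
  set D := derivSup L.φ with hD
  have hDb : ∀ ξ ∈ Set.Icc (-Real.pi) Real.pi, ‖deriv L.φ ξ‖ ≤ D := fun ξ hξ =>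
    le_csSup (isCompact_Icc.bddAbove_image (by fun_prop)) ⟨ξ, hξ, rfl⟩
  have hD0 : 0 ≤ D := (norm_nonneg _).trans (hDb 0 ⟨by linarith, hpi.le⟩)
  -- the two derivative pieces
  set d : ℝ → ℂ := fun ξ => ((-cutD ε ξ : ℝ) : ℂ) * Complex.exp ((lam : ℂ) * L.φ ξ) with hd
  set e : ℝ → ℂ := fun ξ => ((1 - cut ε ξ : ℝ) : ℂ) *
    (Complex.exp ((lam : ℂ) * L.φ ξ) * ((lam : ℂ) * deriv L.φ ξ)) with he
  have hcutDBM : BM (fun ξ => ((-cutD ε ξ : ℝ) : ℂ)) := by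
    refine ⟨(Complex.measurable_ofReal.comp (cutD_meas ε).neg).aestronglyMeasurable, 2 / ε,
      fun x _ => ?_⟩
    rw [Complex.norm_real, norm_neg]
    exact cutD_abs_le ε x hε0
  have hdBM : BM d := hcutDBM.mul (BM.of_cont hEc)
  have heBM : BM e := BM.of_cont (by fun_prop)
  have hib : ∀ n : ℤ, fCoeff d n + fCoeff e n = Complex.I * n *
      fCoeff (fun ξ : ℝ => ((1 - cut ε ξ : ℝ) : ℂ) * Complex.exp ((lam : ℂ) * L.φ ξ)) n := by
    intro n
    rw [← fCoeff_add hdBM heBM]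
    refine ibp (s := {ε, -ε, ε / 2, -(ε / 2)}) (Set.Finite.countable (by simp)) hFc.continuousOn
      (hdBM.add heBM) ?_ ?_ n
    · rintro x ⟨-, hx⟩
      simp only [Set.mem_insert_iff, Set.mem_singleton_iff, not_or] at hx
      have h1 := ((cut_deriv ε x hε0 hx.1 hx.2.1 hx.2.2.1 hx.2.2.2).const_sub 1).ofReal_comp
      have h2 := ((levy_diff L x).const_mul (lam : ℂ)).cexp
      exact h1.mul h2
    · have hcute : cut ε (-Real.pi) = cut ε Real.pi := by unfold cut; rw [abs_neg]
      have hφe : L.φ (-Real.pi) = L.φ Real.pi := by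
        have := L.periodic (-Real.pi)
        rw [← this]; congr 1; ring
      simp only [hcute, hφe]
  have hFle : ∀ x ∈ Set.Ioc (-Real.pi) Real.pi,
      ‖((1 - cut ε x : ℝ) : ℂ) * Complex.exp ((lam : ℂ) * L.φ x)‖ ≤ K := by
    intro x hx
    rw [norm_mul, hn1]
    exact hcE x (Set.Ioc_subset_Icc_self hx)
  obtain ⟨hS, hle⟩ := lemA hdBM heBM hFle hib
  refine ⟨BM.of_cont hFc, hS, hle.trans ?_⟩
  have hPe : Real.sqrt (PP e) ≤ lam * D * K := by
    apply Real.sqrt_le_iff.2 ⟨by positivity, ?_⟩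
    apply PP_le_const heBM
    intro x hx
    apply pow_le_pow_left₀ (norm_nonneg _)
    rw [he]
    simp only
    rw [norm_mul, hn1, norm_mul, norm_mul, Complex.norm_real, Real.norm_of_nonneg hl.le, ← mul_assoc]
    rw [mul_comm]
    exact mul_le_mul (mul_le_mul_of_nonneg_left (hDb x hx) hl.le) (hcE x hx)
      (mul_nonneg (by linarith [cut_le_one ε x hε0]) (norm_nonneg _)) (by positivity)
  have hPd : Real.sqrt (PP d) ≤ Real.sqrt (2 / (Real.pi * ε)) * K := by
    apply Real.sqrt_le_iff.2 ⟨by positivity, ?_⟩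
    rw [mul_pow, Real.sq_sqrt (by positivity)]
    set c : ℝ := (2 / ε) ^ 2 * K ^ 2 with hc
    set G : ℝ → ℝ := fun x => (Set.Ioc (-ε) (-(ε / 2))).indicator (fun _ => c) x +
      (Set.Ioc (ε / 2) ε).indicator (fun _ => c) x with hG
    have hi1 : Integrable ((Set.Ioc (-ε) (-(ε / 2))).indicator (fun _ => c)) := by
      rw [integrable_indicator_iff measurableSet_Ioc]
      exact integrableOn_const (by simp)
    have hi2 : Integrable ((Set.Ioc (ε / 2) ε).indicator (fun _ => c)) := by
      rw [integrable_indicator_iff measurableSet_Ioc]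
      exact integrableOn_const (by simp)
    have hGi : Integrable G := hi1.add hi2
    have hc0 : 0 ≤ c := by positivity
    have hG0 : ∀ x, 0 ≤ G x := fun x =>
      add_nonneg (Set.indicator_nonneg (fun _ _ => hc0) x) (Set.indicator_nonneg (fun _ _ => hc0) x)
    refine (PP_le hdBM (G := G) hGi.intervalIntegrable ?_).trans ?_
    · intro x hx
      have hkey : ε / 2 ≤ |x| → ‖d x‖ ^ 2 ≤ c := by
        intro h
        rw [hc, ← mul_pow, hd]
        apply pow_le_pow_left₀ (norm_nonneg _)
        simp only
        rw [norm_mul, Complex.norm_real, norm_neg]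
        exact mul_le_mul (cutD_abs_le ε x hε0) (hE x hx h) (norm_nonneg _) (by positivity)
      by_cases h1 : x ∈ Set.Ioc (-ε) (-(ε / 2))
      · have hx0 : |x| = -x := abs_of_neg (by linarith [h1.2])
        have := hkey (by rw [hx0]; linarith [h1.2])
        rw [hG]
        simp only [Set.indicator_of_mem h1]
        have := Set.indicator_nonneg (s := Set.Ioc (ε / 2) ε) (f := fun _ => c) (fun _ _ => hc0) x
        linarith
      by_cases h2 : x ∈ Set.Ioc (ε / 2) ε
      · have hx0 : |x| = x := abs_of_pos (by linarith [h2.1])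
        have := hkey (by rw [hx0]; linarith [h2.1])
        rw [hG]
        simp only [Set.indicator_of_mem h2]
        have := Set.indicator_nonneg (s := Set.Ioc (-ε) (-(ε / 2))) (f := fun _ => c)
          (fun _ _ => hc0) x
        linarith
      · have hz : cutD ε x = 0 := by
          unfold cutD
          rw [if_neg (fun h => h2 ⟨h.1, h.2.le⟩), if_neg (fun h => h1 ⟨h.1, h.2.le⟩)]
        have : d x = 0 := by rw [hd]; simp [hz]
        rw [this]; simpa using hG0 x
    · have h1 : ∫ x in (-Real.pi)..Real.pi, G x ≤ ∫ x, G x := by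
        rw [intervalIntegral.integral_of_le negpi_le_pi]
        exact setIntegral_le_integral hGi (Eventually.of_forall hG0)
      have h2 : ∫ x, G x = c * ε := by
        rw [hG, integral_add hi1 hi2, integral_indicator measurableSet_Ioc,
          integral_indicator measurableSet_Ioc]
        simp only [setIntegral_const, smul_eq_mul]
        rw [Measure.real, Measure.real, Real.volume_Ioc, Real.volume_Ioc,
          ENNReal.toReal_ofReal (by linarith), ENNReal.toReal_ofReal (by linarith)]
        ring
      rw [h2] at h1
      refine (mul_le_mul_of_nonneg_left h1 (by positivity)).trans (le_of_eq ?_)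
      rw [hc]
      field_simp
  have hfin := mul_le_mul_of_nonneg_left (add_le_add hPd hPe)
    (show 0 ≤ Real.pi / Real.sqrt 3 by positivity)
  calc _ ≤ K + Real.pi / Real.sqrt 3 * (Real.sqrt (2 / (Real.pi * ε)) * K + lam * D * K) := by
        linarith
    _ = _ := by ring

lemma final_arith (a B ε g X R : ℝ) (ha : 1 ≤ a) (hB : 0 ≤ B) (hε : 0 < ε) (hg : 0 < g)
    (hX : 0 < X) (hR : 0 ≤ R) (pf pd pe : ℝ)
    (hpf : pf ≤ (2 * Real.pi)⁻¹ * (B ^ 2 * (g / (X * a))))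
    (hpd : pd ≤ (2 * Real.pi)⁻¹ * ((2 / ε) ^ 2 * B ^ 2 * (g / (X * a))))
    (hpe : pe ≤ (2 * Real.pi)⁻¹ * (B ^ 2 * ((R + 1) ^ 2 * (g / (R + 1 / 2) / X) +
      6 * (R + 1) * a * (g / (X * a)) + 9 * a ^ 2 * (g * (R + 3 / 2) / (X * a ^ 2))))) :
    Real.sqrt (8 / 7) * (Real.sqrt pd + Real.sqrt (16 * pf + pe)) ≤
      Real.sqrt (2 * Real.pi / 3 * g) * B * (ε⁻¹ + Real.sqrt (5 * (R + 1))) / Real.sqrt X := by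
  have hpi := Real.pi_gt_three
  have ha0 : 0 < a := by linarith
  have hπ2 : 9 < Real.pi ^ 2 := by nlinarith
  set W := B ^ 2 * g / X with hW
  have hW0 : 0 ≤ W := by positivity
  rw [mul_add, mul_add, add_div]
  have hWa : W / a ≤ W := div_le_self hW0 ha
  apply add_le_add
  · rw [← Real.sqrt_mul (by norm_num)]
    apply Real.sqrt_le_iff.2 ⟨by positivity, ?_⟩
    have e1 : (Real.sqrt (2 * Real.pi / 3 * g) * B * ε⁻¹ / Real.sqrt X) ^ 2 =
        2 * Real.pi / 3 * (ε⁻¹) ^ 2 * W := by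
      rw [div_pow, mul_pow, mul_pow, Real.sq_sqrt (by positivity), Real.sq_sqrt hX.le, hW]
      ring
    rw [e1]
    have e2 : (2 * Real.pi)⁻¹ * ((2 / ε) ^ 2 * B ^ 2 * (g / (X * a))) =
        2 * Real.pi⁻¹ * (ε⁻¹) ^ 2 * (W / a) := by
      rw [hW]; field_simp
      try ring
    rw [e2] at hpd
    have e3 : 2 * Real.pi⁻¹ * (ε⁻¹) ^ 2 * (W / a) ≤ 2 * Real.pi⁻¹ * (ε⁻¹) ^ 2 * W :=
      mul_le_mul_of_nonneg_left hWa (by positivity)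
    have e4 : 8 / 7 * (2 * Real.pi⁻¹) ≤ 2 * Real.pi / 3 := by
      rw [← sub_nonneg]
      have : 2 * Real.pi / 3 - 8 / 7 * (2 * Real.pi⁻¹) = (2 * Real.pi ^ 2 / 3 - 16 / 7) / Real.pi := by
        field_simp
        ring
      rw [this]
      apply div_nonneg _ (by linarith)
      linarith
    have e5 := mul_le_mul_of_nonneg_right e4 (show 0 ≤ (ε⁻¹) ^ 2 * W by positivity)
    calc 8 / 7 * pd ≤ 8 / 7 * (2 * Real.pi⁻¹ * (ε⁻¹) ^ 2 * W) := by linarith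
      _ = 8 / 7 * (2 * Real.pi⁻¹) * ((ε⁻¹) ^ 2 * W) := by ring
      _ ≤ _ := e5
      _ = _ := by ring
  · rw [← Real.sqrt_mul (by norm_num)]
    apply Real.sqrt_le_iff.2 ⟨by positivity, ?_⟩
    have e1 : (Real.sqrt (2 * Real.pi / 3 * g) * B * Real.sqrt (5 * (R + 1)) / Real.sqrt X) ^ 2 =
        10 * Real.pi / 3 * (R + 1) * W := by
      rw [div_pow, mul_pow, mul_pow, Real.sq_sqrt (by positivity), Real.sq_sqrt hX.le,
        Real.sq_sqrt (by positivity), hW]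
      ring
    rw [e1]
    have e2 : (2 * Real.pi)⁻¹ * (B ^ 2 * (g / (X * a))) = (2 * Real.pi)⁻¹ * (W / a) := by
      rw [hW]; field_simp
    have e3 : (2 * Real.pi)⁻¹ * (B ^ 2 * ((R + 1) ^ 2 * (g / (R + 1 / 2) / X) +
      6 * (R + 1) * a * (g / (X * a)) + 9 * a ^ 2 * (g * (R + 3 / 2) / (X * a ^ 2)))) =
        (2 * Real.pi)⁻¹ * (W * ((R + 1) ^ 2 / (R + 1 / 2) + 6 * (R + 1) + 9 * (R + 3 / 2))) := by
      rw [hW]; field_simp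
    rw [e2] at hpf
    rw [e3] at hpe
    have e4 : (R + 1) ^ 2 / (R + 1 / 2) ≤ 2 * (R + 1) := by
      rw [div_le_iff₀ (by linarith)]; nlinarith
    have e5 : (R + 1) ^ 2 / (R + 1 / 2) + 6 * (R + 1) + 9 * (R + 3 / 2) ≤ 43 / 2 * (R + 1) := by
      linarith
    have e6 := mul_le_mul_of_nonneg_left e5 hW0
    have e7 : W ≤ W * (R + 1) := le_mul_of_one_le_right hW0 (by linarith)
    have hp2 : 0 < (2 * Real.pi)⁻¹ := by positivity
    have e8 : 16 * (W / a) + W * ((R + 1) ^ 2 / (R + 1 / 2) + 6 * (R + 1) + 9 * (R + 3 / 2)) ≤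
        75 / 2 * (W * (R + 1)) := by linarith
    have e9 := mul_le_mul_of_nonneg_left e8 hp2.le
    have e10 : 8 / 7 * ((2 * Real.pi)⁻¹ * (75 / 2)) ≤ 10 * Real.pi / 3 := by
      rw [← sub_nonneg]
      have : 10 * Real.pi / 3 - 8 / 7 * ((2 * Real.pi)⁻¹ * (75 / 2)) =
          (10 * Real.pi ^ 2 / 3 - 150 / 7) / Real.pi := by
        field_simp
        ring
      rw [this]
      apply div_nonneg _ (by linarith)
      linarith
    have e11 := mul_le_mul_of_nonneg_right e10 (show 0 ≤ (R + 1) * W by positivity)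
    calc 8 / 7 * (16 * pf + pe) ≤ 8 / 7 * ((2 * Real.pi)⁻¹ * (75 / 2 * (W * (R + 1)))) := by
          linarith
      _ = 8 / 7 * ((2 * Real.pi)⁻¹ * (75 / 2)) * ((R + 1) * W) := by ring
      _ ≤ _ := e11
      _ = _ := by ring
lemma gauss_ii (a : ℝ) (k : ℕ) (c : ℝ) : IntervalIntegrable
    (fun x : ℝ => c * (x ^ (2 * k) * Real.exp (-a * x ^ 2))) volume (-Real.pi) Real.pi :=
  Continuous.intervalIntegrable (by fun_prop) _ _

lemma partf (L : LevyExponent) {ε lam : ℝ} (r : ℕ) (hε0 : 0 < ε) (hεπ : ε ≤ Real.pi)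
    (hγ : gammaB L.φ L.σ2 ε ≤ L.σ2 / 2) (hlam : 2 / L.σ2 ≤ lam) {h : ℝ → ℂ} (hh : Continuous h)
    {B : ℝ} (hB : 0 ≤ B) (hb : ∀ ξ ∈ Set.Icc (-ε) ε, ‖h ξ‖ ≤ B * |ξ| ^ (r + 1))
    (hd : ∀ ξ ∈ Set.Ioo (-ε) ε, HasDerivAt h (deriv h ξ) ξ)
    (hb' : ∀ ξ ∈ Set.Ioo (-ε) ε, ‖deriv h ξ‖ ≤ (r + 1) * B * |ξ| ^ r) :
    Summable (fun n => ‖fCoeff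
      (fun ξ : ℝ => ((cut ε ξ : ℝ) : ℂ) * Complex.exp ((lam : ℂ) * L.φ ξ) * h ξ) n‖) ∧
    ∑' n, ‖fCoeff (fun ξ : ℝ => ((cut ε ξ : ℝ) : ℂ) * Complex.exp ((lam : ℂ) * L.φ ξ) * h ξ) n‖ ≤
      Real.sqrt (2 * Real.pi / 3 * Real.Gamma (r + 3 / 2)) * B *
        (ε⁻¹ + Real.sqrt (5 * (r + 1))) / (L.σ2 * lam / 2) ^ ((r : ℝ) / 2 + 1 / 4) := by
  have hpi := Real.pi_pos
  have hσ := L.σ2_pos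
  have hl : 0 < lam := lt_of_lt_of_le (by positivity) hlam
  set a := L.σ2 * lam / 2 with ha_def
  have ha : 1 ≤ a := by
    rw [div_le_iff₀ hσ] at hlam
    rw [ha_def]; linarith
  have ha0 : 0 < a := by linarith
  have hloc := levy_local L hγ
  have hcut := cut_cont ε hε0
  have hφ : Continuous L.φ := L.smooth.continuous
  have hφ' := levy_deriv_cont L
  have hEc : Continuous (fun ξ : ℝ => Complex.exp ((lam : ℂ) * L.φ ξ)) := by fun_prop
  set f : ℝ → ℂ := fun ξ => ((cut ε ξ : ℝ) : ℂ) * Complex.exp ((lam : ℂ) * L.φ ξ) * h ξ with hf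
  set d : ℝ → ℂ := fun ξ => ((cutD ε ξ : ℝ) : ℂ) * (Complex.exp ((lam : ℂ) * L.φ ξ) * h ξ) with hdd
  set e : ℝ → ℂ := fun ξ => ((cut ε ξ : ℝ) : ℂ) * (Complex.exp ((lam : ℂ) * L.φ ξ) *
    ((lam : ℂ) * (deriv L.φ ξ - Complex.I * (L.m : ℂ)) * h ξ + deriv h ξ)) with hee
  have hE : ∀ ξ ∈ Set.Icc (-ε) ε, ‖Complex.exp ((lam : ℂ) * L.φ ξ)‖ ^ 2 ≤
      Real.exp (-a * ξ ^ 2) := by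
    intro ξ hξ
    rw [norm_exp_lam, ← Real.exp_nat_mul]
    apply Real.exp_le_exp.2
    have h1 := mul_le_mul_of_nonneg_left (hloc ξ hξ).2 hl.le
    push_cast
    calc 2 * (lam * (L.φ ξ).re) ≤ 2 * (lam * -(L.σ2 * ξ ^ 2 / 4)) := by linarith
      _ = _ := by rw [ha_def]; ring
  have hcn : ∀ ξ, ‖((cut ε ξ : ℝ) : ℂ)‖ ≤ 1 := fun ξ => by
    rw [Complex.norm_real, Real.norm_of_nonneg (cut_nonneg ε ξ hε0)]
    exact cut_le_one ε ξ hε0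
  have habs : ∀ (ξ : ℝ) (k : ℕ), ξ ^ (2 * k) = (|ξ| ^ k) ^ 2 := fun ξ k => by
    rw [← pow_mul, mul_comm k 2, pow_mul, pow_mul, sq_abs]
  -- pointwise bounds
  have hEh : ∀ ξ ∈ Set.Icc (-ε) ε, ‖Complex.exp ((lam : ℂ) * L.φ ξ) * h ξ‖ ^ 2 ≤
      B ^ 2 * (ξ ^ (2 * (r + 1)) * Real.exp (-a * ξ ^ 2)) := by
    intro ξ hξ
    rw [norm_mul, mul_pow, habs]
    have h2 := pow_le_pow_left₀ (norm_nonneg _) (hb ξ hξ) 2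
    calc _ ≤ Real.exp (-a * ξ ^ 2) * (B * |ξ| ^ (r + 1)) ^ 2 :=
          mul_le_mul (hE ξ hξ) h2 (by positivity) (by positivity)
      _ = _ := by ring
  have hG0 : ∀ (ξ : ℝ) (k : ℕ), 0 ≤ ξ ^ (2 * k) * Real.exp (-a * ξ ^ 2) := fun ξ k => by
    rw [habs]; positivity
  have pf : ∀ ξ, ‖f ξ‖ ^ 2 ≤ B ^ 2 * (ξ ^ (2 * (r + 1)) * Real.exp (-a * ξ ^ 2)) := by
    intro ξ
    by_cases hξ : ξ ∈ Set.Icc (-ε) ε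
    · refine le_trans ?_ (hEh ξ hξ)
      rw [hf]
      simp only
      rw [mul_assoc, norm_mul]
      exact pow_le_pow_left₀ (by positivity) (mul_le_of_le_one_left (norm_nonneg _) (hcn ξ)) 2
    · have : f ξ = 0 := by
        rw [hf]; simp only
        rw [cut_zero ε ξ hε0 (by rw [Set.mem_Icc, ← abs_le] at hξ; linarith)]
        simp
      rw [this]
      have := hG0 ξ (r + 1)
      simp only [norm_zero, ne_eq, OfNat.ofNat_ne_zero, not_false_eq_true, zero_pow]
      positivity
  have pd : ∀ ξ, ‖d ξ‖ ^ 2 ≤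
      (2 / ε) ^ 2 * B ^ 2 * (ξ ^ (2 * (r + 1)) * Real.exp (-a * ξ ^ 2)) := by
    intro ξ
    by_cases hξ : ξ ∈ Set.Icc (-ε) ε
    · rw [mul_assoc, hdd]
      simp only
      rw [norm_mul, mul_pow, Complex.norm_real]
      exact mul_le_mul (pow_le_pow_left₀ (norm_nonneg _) (cutD_abs_le ε ξ hε0) 2) (hEh ξ hξ)
        (by positivity) (by positivity)
    · have : d ξ = 0 := by
        rw [hdd]; simp only
        rw [cutD_zero ε ξ hε0 (Or.inr (by rw [Set.mem_Icc, ← abs_le] at hξ; linarith))]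
        simp
      rw [this]
      have := hG0 ξ (r + 1)
      simp only [norm_zero, ne_eq, OfNat.ofNat_ne_zero, not_false_eq_true, zero_pow]
      positivity
  have pe : ∀ ξ, ‖e ξ‖ ^ 2 ≤
      B ^ 2 * (r + 1) ^ 2 * (ξ ^ (2 * r) * Real.exp (-a * ξ ^ 2)) +
      B ^ 2 * (6 * (r + 1) * a) * (ξ ^ (2 * (r + 1)) * Real.exp (-a * ξ ^ 2)) +
      B ^ 2 * (9 * a ^ 2) * (ξ ^ (2 * (r + 2)) * Real.exp (-a * ξ ^ 2)) := by
    intro ξ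
    by_cases hξ : ξ ∈ Set.Ioo (-ε) ε
    · have hξ' := Set.Ioo_subset_Icc_self hξ
      have h1 : ‖(lam : ℂ) * (deriv L.φ ξ - Complex.I * (L.m : ℂ)) * h ξ + deriv h ξ‖ ≤
          B * (3 * a * |ξ| ^ (r + 2) + (r + 1) * |ξ| ^ r) := by
        refine (norm_add_le _ _).trans ?_
        rw [norm_mul, norm_mul, Complex.norm_real, Real.norm_of_nonneg hl.le]
        have h3 : lam * ‖deriv L.φ ξ - Complex.I * (L.m : ℂ)‖ ≤ 3 * a * |ξ| := by
          refine (mul_le_mul_of_nonneg_left (hloc ξ hξ').1 hl.le).trans (le_of_eq ?_)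
          rw [ha_def]; ring
        have h4 := mul_le_mul h3 (hb ξ hξ') (norm_nonneg _) (by positivity)
        refine (add_le_add h4 (hb' ξ hξ)).trans (le_of_eq ?_)
        ring
      have h2 : ‖e ξ‖ ^ 2 ≤ ‖Complex.exp ((lam : ℂ) * L.φ ξ)‖ ^ 2 *
          ‖(lam : ℂ) * (deriv L.φ ξ - Complex.I * (L.m : ℂ)) * h ξ + deriv h ξ‖ ^ 2 := by
        rw [← mul_pow, ← norm_mul, hee]
        simp only
        rw [norm_mul]
        exact pow_le_pow_left₀ (by positivity) (mul_le_of_le_one_left (norm_nonneg _) (hcn ξ)) 2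
      refine h2.trans ?_
      refine (mul_le_mul (hE ξ hξ') (pow_le_pow_left₀ (norm_nonneg _) h1 2) (by positivity)
        (by positivity)).trans (le_of_eq ?_)
      rw [habs, habs, habs]
      ring
    · have : e ξ = 0 := by
        rw [hee]; simp only
        rw [cut_zero ε ξ hε0 (by rw [Set.mem_Ioo, ← abs_lt] at hξ; linarith)]
        simp
      rw [this]
      have := hG0 ξ (r + 1)
      have := hG0 ξ r
      have := hG0 ξ (r + 2)
      simp only [norm_zero, ne_eq, OfNat.ofNat_ne_zero, not_false_eq_true, zero_pow]
      positivity
  have hfc : Continuous f := by rw [hf]; fun_prop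
  have hfBM : BM f := BM.of_cont hfc
  have hdBM : BM d := by
    refine BM.mul ⟨(Complex.measurable_ofReal.comp (cutD_meas ε)).aestronglyMeasurable, 2 / ε,
      fun x _ => ?_⟩ (BM.of_cont (by fun_prop))
    rw [Complex.norm_real]
    exact cutD_abs_le ε x hε0
  have heBM : BM e := by
    refine ⟨?_, ?_⟩
    · have hm : Measurable (deriv h) := measurable_deriv h
      have h1 : Measurable (fun ξ : ℝ => ((cut ε ξ : ℝ) : ℂ)) := by
        apply Continuous.measurable; fun_prop
      have h2 : Measurable (fun ξ : ℝ => (lam : ℂ) * (deriv L.φ ξ - Complex.I * (L.m : ℂ)) * h ξ) := by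
        apply Continuous.measurable; fun_prop
      exact (h1.mul (hEc.measurable.mul (h2.add hm))).aestronglyMeasurable
    · obtain ⟨C, hC⟩ := (isCompact_Icc (a := -Real.pi) (b := Real.pi)).exists_bound_of_continuousOn
        (f := fun ξ : ℝ => B ^ 2 * (r + 1) ^ 2 * (ξ ^ (2 * r) * Real.exp (-a * ξ ^ 2)) +
          B ^ 2 * (6 * (r + 1) * a) * (ξ ^ (2 * (r + 1)) * Real.exp (-a * ξ ^ 2)) +
          B ^ 2 * (9 * a ^ 2) * (ξ ^ (2 * (r + 2)) * Real.exp (-a * ξ ^ 2)))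
        (Continuous.continuousOn (by fun_prop))
      refine ⟨Real.sqrt C, fun x hx => Real.le_sqrt_of_sq_le ?_⟩
      exact (pe x).trans ((le_abs_self _).trans (hC x (Set.Ioc_subset_Icc_self hx)))
  have hib : ∀ n : ℤ, fCoeff d n + fCoeff e n =
      Complex.I * ((n : ℝ) - lam * L.m : ℝ) * fCoeff f n := by
    intro n
    have hcBM : BM (fun x => (Complex.I * (lam : ℂ) * (L.m : ℂ)) * f x) :=
      BM.of_cont (by fun_prop)
    have key : fCoeff (fun x => d x + e x + (Complex.I * (lam : ℂ) * (L.m : ℂ)) * f x) n =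
        Complex.I * n * fCoeff f n := by
      refine ibp (s := {ε, -ε, ε / 2, -(ε / 2)}) (Set.Finite.countable (by simp)) hfc.continuousOn
        ((hdBM.add heBM).add hcBM) ?_ ?_ n
      · rintro x ⟨-, hx⟩
        simp only [Set.mem_insert_iff, Set.mem_singleton_iff, not_or] at hx
        by_cases hxI : x ∈ Set.Ioo (-ε) ε
        · have h1 := ((cut_deriv ε x hε0 hx.1 hx.2.1 hx.2.2.1 hx.2.2.2)).ofReal_comp
          have h2 := ((levy_diff L x).const_mul (lam : ℂ)).cexp
          have h3 := (h1.mul h2).mul (hd x hxI)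
          refine h3.congr_deriv ?_
          simp only [hf, hdd, hee, Pi.mul_apply]
          ring
        · have hxa : ε < |x| := by
            rw [Set.mem_Ioo, ← abs_lt, not_lt] at hxI
            refine lt_of_le_of_ne hxI (fun h0 => ?_)
            rcases abs_choice x with h' | h' <;> rw [h'] at h0
            · exact hx.1 h0.symm
            · exact hx.2.1 (by linarith)
          have hz : ∀ y, ε ≤ |y| → f y = 0 := fun y hy => by
            simp only [hf, cut_zero ε y hε0 hy]; simp
          have hv : d x + e x + (Complex.I * (lam : ℂ) * (L.m : ℂ)) * f x = 0 := by
            rw [hz x hxa.le]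
            simp only [hdd, hee, cut_zero ε x hε0 hxa.le, cutD_zero ε x hε0 (Or.inr hxa.le)]
            simp
          rw [hv]
          refine (hasDerivAt_const x (0 : ℂ)).congr_of_eventuallyEq ?_
          filter_upwards [continuous_abs.continuousAt.eventually (lt_mem_nhds hxa)] with y hy
          exact hz y hy.le
      · have h1 : ε ≤ |(-Real.pi)| := by rw [abs_neg, abs_of_pos hpi]; exact hεπ
        have h2 : ε ≤ |Real.pi| := by rw [abs_of_pos hpi]; exact hεπ
        simp only [hf, cut_zero ε _ hε0 h1, cut_zero ε _ hε0 h2]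
        simp
    rw [fCoeff_add (hdBM.add heBM) hcBM, fCoeff_add hdBM heBM, fCoeff_const_mul] at key
    push_cast
    linear_combination key
  obtain ⟨hS, hle⟩ := lemB hfBM hdBM heBM hib
  refine ⟨hS, hle.trans ?_⟩
  set g := Real.Gamma ((r : ℝ) + 3 / 2) with hg
  have hg0 : 0 < g := Real.Gamma_pos_of_pos (by positivity)
  set X := a ^ ((r : ℝ) + 1 / 2) with hX
  have hX0 : 0 < X := Real.rpow_pos_of_pos ha0 _
  have hsX : Real.sqrt X = a ^ ((r : ℝ) / 2 + 1 / 4) := by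
    rw [hX, Real.sqrt_eq_rpow, ← Real.rpow_mul ha0.le]
    congr 1; ring
  rw [← hsX]
  have J1 : ∫ x in (-Real.pi)..Real.pi, x ^ (2 * (r + 1)) * Real.exp (-a * x ^ 2) ≤
      g / (X * a) := by
    refine (gauss_moment a ha0 (r + 1)).trans (le_of_eq ?_)
    have : (((r + 1 : ℕ) : ℝ) + 1 / 2) = (r : ℝ) + 3 / 2 := by push_cast; ring
    rw [this, Real.rpow_neg ha0.le, ← div_eq_mul_inv]
    congr 1
    rw [hX, ← Real.rpow_add_one ha0.ne']
    congr 1; ring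
  have J0 : ∫ x in (-Real.pi)..Real.pi, x ^ (2 * r) * Real.exp (-a * x ^ 2) ≤
      g / ((r : ℝ) + 1 / 2) / X := by
    refine (gauss_moment a ha0 r).trans (le_of_eq ?_)
    rw [Real.rpow_neg ha0.le, ← div_eq_mul_inv]
    congr 1
    have : (r : ℝ) + 3 / 2 = (r : ℝ) + 1 / 2 + 1 := by ring
    rw [hg, this, Real.Gamma_add_one (by positivity)]
    field_simp
  have J2 : ∫ x in (-Real.pi)..Real.pi, x ^ (2 * (r + 2)) * Real.exp (-a * x ^ 2) ≤
      g * ((r : ℝ) + 3 / 2) / (X * a ^ 2) := by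
    refine (gauss_moment a ha0 (r + 2)).trans (le_of_eq ?_)
    have : (((r + 2 : ℕ) : ℝ) + 1 / 2) = (r : ℝ) + 3 / 2 + 1 := by push_cast; ring
    rw [this, Real.rpow_neg ha0.le, ← div_eq_mul_inv, Real.Gamma_add_one (by positivity), mul_comm]
    congr 1
    rw [hX, pow_two, ← mul_assoc, ← Real.rpow_add_one ha0.ne', ← Real.rpow_add_one ha0.ne']
    congr 1; ring
  have hp2 : 0 ≤ (2 * Real.pi)⁻¹ := by positivity
  refine final_arith a B ε g X r ha hB hε0 hg0 hX0 (by positivity) _ _ _ ?_ ?_ ?_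
  · refine (PP_le hfBM (gauss_ii a (r + 1) _) (fun x _ => pf x)).trans
      (mul_le_mul_of_nonneg_left ?_ hp2)
    rw [intervalIntegral.integral_const_mul]
    exact mul_le_mul_of_nonneg_left J1 (by positivity)
  · refine (PP_le hdBM (gauss_ii a (r + 1) _) (fun x _ => pd x)).trans
      (mul_le_mul_of_nonneg_left ?_ hp2)
    rw [intervalIntegral.integral_const_mul]
    exact mul_le_mul_of_nonneg_left J1 (by positivity)
  · refine (PP_le heBM (((gauss_ii a r _).add (gauss_ii a (r + 1) _)).add
      (gauss_ii a (r + 2) _)) (fun x _ => pe x)).trans (mul_le_mul_of_nonneg_left ?_ hp2)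
    rw [intervalIntegral.integral_add ((gauss_ii a r _).add (gauss_ii a (r + 1) _))
      (gauss_ii a (r + 2) _), intervalIntegral.integral_add (gauss_ii a r _)
      (gauss_ii a (r + 1) _), intervalIntegral.integral_const_mul,
      intervalIntegral.integral_const_mul, intervalIntegral.integral_const_mul]
    have k0 := mul_le_mul_of_nonneg_left J0 (show 0 ≤ B ^ 2 * ((r : ℝ) + 1) ^ 2 by positivity)
    have k1 := mul_le_mul_of_nonneg_left J1 (show 0 ≤ B ^ 2 * (6 * ((r : ℝ) + 1) * a) by positivity)
    have k2 := mul_le_mul_of_nonneg_left J2 (show 0 ≤ B ^ 2 * (9 * a ^ 2) by positivity)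
    refine (add_le_add (add_le_add k0 k1) k2).trans (le_of_eq ?_)
    ring

lemma MemWiener.cont {f : ℝ → ℂ} (hf : MemWiener f) : Continuous f := by
  have := series_cont hf.1
  rwa [← funext hf.2] at this

lemma MemWiener.sub {f g : ℝ → ℂ} (hf : MemWiener f) (hg : MemWiener g) :
    MemWiener (fun ξ => f ξ - g ξ) := by
  have hc := fCoeff_sub (BM.of_cont hf.cont) (BM.of_cont hg.cont)
  have hs : ∀ {f : ℝ → ℂ}, MemWiener f → ∀ ξ : ℝ, Summable (fun n : ℤ =>
      fCoeff f n * Complex.exp (Complex.I * (n : ℂ) * (ξ : ℂ))) := fun hf ξ => by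
    refine Summable.of_norm ?_
    refine hf.1.congr (fun n => ?_)
    rw [norm_mul, norm_cexp_I, mul_one]
  refine ⟨?_, fun ξ => ?_⟩
  · simp only [hc]
    exact Summable.of_nonneg_of_le (fun _ => norm_nonneg _) (fun n => norm_sub_le _ _)
      (hf.1.add hg.1)
  · simp only [hc, sub_mul]
    rw [(hs hf ξ).tsum_sub (hs hg ξ), ← hf.2, ← hg.2]

lemma main_bound (L : LevyExponent) (r : ℕ) (ε lam : ℝ) (ψ χ : ℝ → ℂ)
    (hε0 : 0 < ε) (hεπ : ε ≤ Real.pi)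
    (hγ : gammaB L.φ L.σ2 ε ≤ L.σ2 / 2)
    (hlam : 2 / L.σ2 ≤ lam)
    (hψA : MemWiener ψ) (hχA : MemWiener χ)
    (hψC : ContDiffOn ℝ ((r + 1 : ℕ) : ℕ∞) ψ (Set.Icc (-ε) ε))
    (hχC : ContDiffOn ℝ ((r + 1 : ℕ) : ℕ∞) χ (Set.Icc (-ε) ε))
    (hvanish : ∀ s : ℕ, s ≤ r →
      iteratedDerivWithin s (fun ξ => ψ ξ - χ ξ) (Set.Icc (-ε) ε) 0 = 0) :
    wienerNorm (fun ξ =>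
        Complex.exp ((lam : ℂ) * L.φ ξ) * ψ ξ - Complex.exp ((lam : ℂ) * L.φ ξ) * χ ξ) ≤
      wienerNorm (fun ξ => ψ ξ - χ ξ) *
          ((1 + (Real.pi / Real.sqrt 3) *
              (Real.sqrt (2 / (Real.pi * ε)) + lam * derivSup L.φ)) *
            Real.exp (-(lam * Mconst L.φ * ε ^ 2) / 4)) +
        Cconst (r + 1) * betaSup r ε ψ χ * (ε⁻¹ + Real.sqrt (5 * (r + 1))) /
          (L.σ2 * lam / 2) ^ ((r : ℝ) / 2 + 1 / 4) := by
  have hσ := L.σ2_pos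
  have hl : 0 < lam := lt_of_lt_of_le (by positivity) hlam
  have hA := hψA.sub hχA
  have hC : ContDiffOn ℝ ((r + 1 : ℕ) : ℕ∞) (fun ξ => ψ ξ - χ ξ) (Set.Icc (-ε) ε) := hψC.sub hχC
  set β := betaSup r ε ψ χ with hβ
  unfold betaSup at hβ
  set h : ℝ → ℂ := fun ξ => ψ ξ - χ ξ with hh
  have hC' : ContDiffOn ℝ (((r + 1 : ℕ) : WithTop ℕ∞)) h (Set.Icc (-ε) ε) := by exact_mod_cast hC
  have hcont : Continuous h := hA.cont
  have hU : UniqueDiffOn ℝ (Set.Icc (-ε) ε) := uniqueDiffOn_Icc (by linarith)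
  have hβb : ∀ y ∈ Set.Icc (-ε) ε, ‖iteratedDerivWithin (r + 1) h (Set.Icc (-ε) ε) y‖ ≤ β := by
    intro y hy
    rw [hβ]
    refine le_csSup (isCompact_Icc.bddAbove_image ?_) ⟨y, hy, rfl⟩
    exact (hC'.continuousOn_iteratedDerivWithin le_rfl hU).norm
  have h0mem : (0 : ℝ) ∈ Set.Icc (-ε) ε := ⟨by linarith, hε0.le⟩
  have hβ0 : 0 ≤ β := (norm_nonneg _).trans (hβb 0 h0mem)
  have hfac : (0 : ℝ) < (r + 1).factorial := by positivity
  set B := β / ((r + 1).factorial : ℝ) with hB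
  have hB0 : 0 ≤ B := by positivity
  have hb : ∀ ξ ∈ Set.Icc (-ε) ε, ‖h ξ‖ ≤ B * |ξ| ^ (r + 1) := by
    intro ξ hξ
    refine (taylor_bound (r + 1) hε0 hC' (fun s hs => hvanish s (by omega)) hβb ξ hξ).trans
      (le_of_eq ?_)
    rw [hB]; ring
  have hdw : ContDiffOn ℝ (r : WithTop ℕ∞) (derivWithin h (Set.Icc (-ε) ε)) (Set.Icc (-ε) ε) :=
    hC'.derivWithin hU (by norm_cast)
  have hb1 : ∀ ξ ∈ Set.Icc (-ε) ε, ‖derivWithin h (Set.Icc (-ε) ε) ξ‖ ≤ (r + 1) * B * |ξ| ^ r := by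
    intro ξ hξ
    refine (taylor_bound r (C := β) hε0 hdw (fun s hs => ?_) (fun y hy => ?_) ξ hξ).trans (le_of_eq ?_)
    · rw [← iteratedDerivWithin_succ']
      exact hvanish (s + 1) (by omega)
    · rw [← iteratedDerivWithin_succ']
      exact hβb y hy
    · rw [hB, Nat.factorial_succ]
      push_cast
      field_simp
  have hnh : ∀ ξ ∈ Set.Ioo (-ε) ε, Set.Icc (-ε) ε ∈ 𝓝 ξ := fun ξ hξ => Icc_mem_nhds hξ.1 hξ.2
  have hd : ∀ ξ ∈ Set.Ioo (-ε) ε, HasDerivAt h (deriv h ξ) ξ := fun ξ hξ =>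
    ((hC'.differentiableOn (by norm_cast)).differentiableAt (hnh ξ hξ)).hasDerivAt
  have hb' : ∀ ξ ∈ Set.Ioo (-ε) ε, ‖deriv h ξ‖ ≤ (r + 1) * B * |ξ| ^ r := fun ξ hξ => by
    rw [← derivWithin_of_mem_nhds (hnh ξ hξ)]
    exact hb1 ξ (Set.Ioo_subset_Icc_self hξ)
  obtain ⟨s1, t1⟩ := partf L r hε0 hεπ hγ hlam hcont hB0 hb hd hb'
  obtain ⟨hFBM, hFs, hFle⟩ := partF L hε0 hεπ hl
  obtain ⟨s2, t2⟩ := wiener_prod hA hFBM hFs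
  have hcut := cut_cont ε hε0
  have hφ : Continuous L.φ := L.smooth.continuous
  have hsplit : (fun ξ : ℝ =>
        Complex.exp ((lam : ℂ) * L.φ ξ) * ψ ξ - Complex.exp ((lam : ℂ) * L.φ ξ) * χ ξ) =
      fun ξ : ℝ => h ξ * (((1 - cut ε ξ : ℝ) : ℂ) * Complex.exp ((lam : ℂ) * L.φ ξ)) +
        ((cut ε ξ : ℝ) : ℂ) * Complex.exp ((lam : ℂ) * L.φ ξ) * h ξ := by
    funext ξ
    rw [hh]; push_cast; ring
  have hco := fCoeff_add ((BM.of_cont hcont).mul hFBM)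
    (BM.of_cont (show Continuous (fun ξ : ℝ =>
      ((cut ε ξ : ℝ) : ℂ) * Complex.exp ((lam : ℂ) * L.φ ξ) * h ξ) by fun_prop))
  have hCB : Cconst (r + 1) * β =
      Real.sqrt (2 * Real.pi / 3 * Real.Gamma (r + 3 / 2)) * B := by
    unfold Cconst
    have : (((r + 1 : ℕ) : ℝ) + 1 / 2) = (r : ℝ) + 3 / 2 := by push_cast; ring
    rw [this, hB]; ring
  rw [hCB, hsplit]
  unfold wienerNorm at t2 ⊢
  simp only [hco]
  have hsum : ∑' n : ℤ, ‖fCoeff (fun ξ : ℝ => h ξ *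
        (((1 - cut ε ξ : ℝ) : ℂ) * Complex.exp ((lam : ℂ) * L.φ ξ))) n +
      fCoeff (fun ξ : ℝ => ((cut ε ξ : ℝ) : ℂ) * Complex.exp ((lam : ℂ) * L.φ ξ) * h ξ) n‖ ≤ _ :=
    Summable.tsum_le_tsum (fun n => norm_add_le _ _)
      (Summable.of_nonneg_of_le (fun _ => norm_nonneg _) (fun n => norm_add_le _ _) (s2.add s1))
      (s2.add s1)
  rw [s2.tsum_add s1] at hsum
  have hW0 : 0 ≤ ∑' n : ℤ, ‖fCoeff h n‖ := tsum_nonneg (fun _ => norm_nonneg _)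
  refine hsum.trans (add_le_add (t2.trans ?_) t1)
  exact mul_le_mul_of_nonneg_left hFle hW0

lemma dTV_eq {μ ν : ℤ → ℝ} (hμ : IsFiniteSigned μ) (hν : IsFiniteSigned ν) :
    dTV μ ν = wienerNorm (fun ξ => fhat μ ξ - fhat ν ξ) := by
  have hs : ∀ {μ : ℤ → ℝ}, IsFiniteSigned μ → Summable (fun k => ‖((μ k : ℝ) : ℂ)‖) := fun h => by
    refine h.congr (fun k => ?_)
    rw [Complex.norm_real, Real.norm_eq_abs]
  unfold dTV wienerNorm
  refine tsum_congr (fun k => ?_)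
  rw [fCoeff_sub (f := fhat μ) (g := fhat ν) (BM.of_cont (series_cont (hs hμ)))
    (BM.of_cont (series_cont (hs hν)))]
  have h1 : fCoeff (fhat μ) k = (μ k : ℂ) := fCoeff_series (hs hμ) k
  have h2 : fCoeff (fhat ν) k = (ν k : ℂ) := fCoeff_series (hs hν) k
  rw [h1, h2, ← Complex.ofReal_sub, Complex.norm_real, Real.norm_eq_abs]

/-- Theorem 2.3 (norm estimate): in the one-dimensional concentration setting,
`‖e^{λφ}ψ − e^{λφ}χ‖_A ≤ ‖ψ−χ‖_A·(1 + C_H(√(2/(πε)) + λ‖φ′‖_∞))·e^{−λMε²/4}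
 + C_{r+1}·β_{r+1}(ε)·(ε⁻¹+√(5(r+1)))/(σ²λ/2)^{r/2+1/4}`;
in particular, if `μ̂ = e^{λφ}ψ` and `ν̂ = e^{λφ}χ`, then `d_TV(μ,ν)` is bounded by
this quantity. -/
theorem norm_estimate (L : LevyExponent) (r : ℕ) (ε lam : ℝ) (ψ χ : ℝ → ℂ)
    (hε0 : 0 < ε) (hεπ : ε ≤ Real.pi)
    (hγ : gammaB L.φ L.σ2 ε ≤ L.σ2 / 2)
    (hlam : 2 / L.σ2 ≤ lam)
    (hψA : MemWiener ψ) (hχA : MemWiener χ)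
    (hψC : ContDiffOn ℝ ((r + 1 : ℕ) : ℕ∞) ψ (Set.Icc (-ε) ε))
    (hχC : ContDiffOn ℝ ((r + 1 : ℕ) : ℕ∞) χ (Set.Icc (-ε) ε))
    (hvanish : ∀ s : ℕ, s ≤ r →
      iteratedDerivWithin s (fun ξ => ψ ξ - χ ξ) (Set.Icc (-ε) ε) 0 = 0) :
    wienerNorm (fun ξ =>
        Complex.exp ((lam : ℂ) * L.φ ξ) * ψ ξ - Complex.exp ((lam : ℂ) * L.φ ξ) * χ ξ) ≤
      wienerNorm (fun ξ => ψ ξ - χ ξ) *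
          ((1 + (Real.pi / Real.sqrt 3) *
              (Real.sqrt (2 / (Real.pi * ε)) + lam * derivSup L.φ)) *
            Real.exp (-(lam * Mconst L.φ * ε ^ 2) / 4)) +
        Cconst (r + 1) * betaSup r ε ψ χ * (ε⁻¹ + Real.sqrt (5 * (r + 1))) /
          (L.σ2 * lam / 2) ^ ((r : ℝ) / 2 + 1 / 4) ∧
    ∀ μ ν : ℤ → ℝ, IsFiniteSigned μ → IsFiniteSigned ν →
      (∀ ξ : ℝ, fhat μ ξ = Complex.exp ((lam : ℂ) * L.φ ξ) * ψ ξ) →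
      (∀ ξ : ℝ, fhat ν ξ = Complex.exp ((lam : ℂ) * L.φ ξ) * χ ξ) →
      dTV μ ν ≤
        wienerNorm (fun ξ => ψ ξ - χ ξ) *
            ((1 + (Real.pi / Real.sqrt 3) *
                (Real.sqrt (2 / (Real.pi * ε)) + lam * derivSup L.φ)) *
              Real.exp (-(lam * Mconst L.φ * ε ^ 2) / 4)) +
          Cconst (r + 1) * betaSup r ε ψ χ * (ε⁻¹ + Real.sqrt (5 * (r + 1))) /
            (L.σ2 * lam / 2) ^ ((r : ℝ) / 2 + 1 / 4) := by
  have hmain := main_bound L r ε lam ψ χ hε0 hεπ hγ hlam hψA hχA hψC hχC hvanish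
  refine ⟨hmain, fun μ ν hμ hν h1 h2 => ?_⟩
  rw [dTV_eq hμ hν]
  simp only [h1, h2]
  exact hmain

end
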